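/- arXiv:2004.11212 — 12 statements merged into one kernel-verified Lean document; each statement's English description precedes it below -/
import Mathlib

section
/- Let A ∈ ℂ^{n×n}, B ∈ ℂ^{n×m}, and let c ∈ ℂ^n be nonzero. Let j ≥ 1 and let q ∈ ℂ[x] be a monic polynomial of degree k ≤ j such that q(A*) is invertible. Suppose the rational Krylov subspace 𝒦 = q(A*)^{−1}·span{c, A*c, …, (A*)^{j−1}c} is A*-variant and has dimension j, and let Z ∈ ℂ^{n×j} be a matrix whose columns form a basis of 𝒦. Then there exists exactly one invertible matrix Y ∈ ℂ^{j×j} such that the matrix A*(ZYZ*) + (ZYZ*)A + cc* − (ZYZ*)BB*(ZYZ*) has rank one, if and only if k = j and no root s of q is such that −conj(s) is also a root of q. Moreover, in that case, if additionally h ∈ ℂ^{1×j} and H ∈ ℂ^{j×j} satisfy A*Z = c·h + Z·H, then this unique Y satisfies Y^{−1}H + H*Y^{−1} = Z*BB*Z + h*h. -/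
open Matrix Polynomial

/-- The polynomial Krylov subspace `span {b, Ab, …, A^(j-1) b}`. -/
noncomputable def polyKrylov {n : ℕ} (A : Matrix (Fin n) (Fin n) ℂ) (b : Fin n → ℂ) (j : ℕ) :
    Submodule ℂ (Fin n → ℂ) :=
  Submodule.span ℂ {x | ∃ i < j, x = (A ^ i).mulVec b}

/-- The rational Krylov subspace `q(A)⁻¹ · 𝒦_j(A,b)`. -/
noncomputable def ratKrylov {n : ℕ} (A : Matrix (Fin n) (Fin n) ℂ) (b : Fin n → ℂ) (j : ℕ)
    (q : Polynomial ℂ) : Submodule ℂ (Fin n → ℂ) :=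
  (polyKrylov A b j).map (Matrix.mulVecLin (aeval A q)⁻¹)

/-- A vector as a one-column matrix. -/
noncomputable def colMat {n : ℕ} (c : Fin n → ℂ) : Matrix (Fin n) (Fin 1) ℂ :=
  Matrix.of fun r _ => c r

namespace Matrix

section Rank

variable {n j : ℕ}

/-- A matrix of rank one over a field is a column times a row. -/
theorem exists_eq_mul_of_rank_eq_one {R : Matrix (Fin n) (Fin n) ℂ} (hR : R.rank = 1) :
    ∃ (a : Matrix (Fin n) (Fin 1) ℂ) (b : Matrix (Fin 1) (Fin n) ℂ), R = a * b := by
  obtain ⟨⟨v, hv⟩, -, hspan⟩ := finrank_eq_one_iff'.1 hR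
  have key : ∀ i, ∃ t : ℂ, t • v = R *ᵥ Pi.single i 1 := fun i => by
    obtain ⟨t, ht⟩ := hspan ⟨R *ᵥ Pi.single i 1, ⟨_, rfl⟩⟩
    exact ⟨t, congrArg Subtype.val ht⟩
  choose t ht using key
  refine ⟨of fun i _ => v i, of fun _ i => t i, ?_⟩
  ext r i
  have := congrFun (ht i) r
  simp only [mulVec_single_one, col_apply, Pi.smul_apply, smul_eq_mul] at this
  simp [mul_apply, ← this, mul_comm]

theorem rank_mul_eq_one {a : Matrix (Fin n) (Fin 1) ℂ} {b : Matrix (Fin 1) (Fin n) ℂ}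
    (hab : a * b ≠ 0) : (a * b).rank = 1 := by
  refine le_antisymm ((rank_mul_le_left a b).trans (rank_le_width a)) ?_
  rw [Nat.one_le_iff_ne_zero]
  contrapose! hab
  have h := Submodule.finrank_eq_zero.1 hab
  rw [LinearMap.range_eq_bot] at h
  exact ext_of_mulVec_single fun i =>
    (LinearMap.congr_fun h (Pi.single i 1)).trans (zero_mulVec _).symm

theorem fin_one_mul_comm (x y : Matrix (Fin 1) (Fin 1) ℂ) : x * y = y * x := by
  ext a b
  fin_cases a; fin_cases b
  simp [mul_apply, mul_comm]

theorem fin_one_mul_eq_zero {x y : Matrix (Fin 1) (Fin 1) ℂ} (h : x * y = 0) :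
    x = 0 ∨ y = 0 := by
  have h0 := congrFun (congrFun h 0) 0
  simp only [mul_apply, Finset.univ_unique, Fin.default_eq_zero, Finset.sum_singleton,
    zero_apply, mul_eq_zero] at h0
  refine h0.imp (fun h => ?_) (fun h => ?_) <;>
  · ext a b
    fin_cases a; fin_cases b
    simpa using h

/-- If `L * R * L'` is the identity scalar, the rank-one matrix `R` is recovered from the row
`L * R` and the column `R * L'`. -/
theorem mul_mul_eq_self_of_rank_eq_one {R : Matrix (Fin n) (Fin n) ℂ} (hR : R.rank = 1)
    {L : Matrix (Fin 1) (Fin n) ℂ} {L' : Matrix (Fin n) (Fin 1) ℂ} (hL : L * R * L' = 1) :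
    R * L' * (L * R) = R := by
  obtain ⟨a, b, rfl⟩ := exists_eq_mul_of_rank_eq_one hR
  have h : b * L' * (L * a) = 1 := by
    rw [fin_one_mul_comm, ← hL]
    simp only [Matrix.mul_assoc]
  calc a * b * L' * (L * (a * b)) = a * (b * L' * (L * a)) * b := by
        simp only [Matrix.mul_assoc]
    _ = a * b := by rw [h, Matrix.mul_one]

theorem mul_eq_zero_or_of_rank_eq_one {R : Matrix (Fin n) (Fin n) ℂ} (hR : R.rank = 1)
    {L : Matrix (Fin 1) (Fin n) ℂ} {L' : Matrix (Fin n) (Fin 1) ℂ} (hL : L * R * L' = 0) :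
    L * R = 0 ∨ R * L' = 0 := by
  obtain ⟨a, b, rfl⟩ := exists_eq_mul_of_rank_eq_one hR
  have h : L * a * (b * L') = 0 := by
    rw [← hL]
    simp only [Matrix.mul_assoc]
  refine (fin_one_mul_eq_zero h).imp (fun h => ?_) (fun h => ?_)
  · rw [← Matrix.mul_assoc, h, Matrix.zero_mul]
  · rw [Matrix.mul_assoc, h, Matrix.mul_zero]

theorem eq_zero_of_mul_eq_zero {l : ℕ} {Z : Matrix (Fin n) (Fin j) ℂ}
    (hZ : Function.Injective Z.mulVec) {M : Matrix (Fin j) (Fin l) ℂ} (h : Z * M = 0) :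
    M = 0 := by
  refine ext_of_mulVec_single fun i => hZ ?_
  rw [mulVec_mulVec, h, zero_mulVec, zero_mulVec, mulVec_zero]

theorem eq_zero_of_mul_conjTranspose_eq_zero {l : ℕ} {Z : Matrix (Fin n) (Fin j) ℂ}
    (hZ : Function.Injective Z.mulVec) {M : Matrix (Fin l) (Fin j) ℂ} (h : M * Zᴴ = 0) :
    M = 0 := by
  have : Mᴴ = 0 := eq_zero_of_mul_eq_zero hZ (by simpa using congrArg conjTranspose h)
  simpa using this

/-- A vector outside the column space of `Z` is separated from it by a row. -/
theorem exists_row_of_notMem_range (Z : Matrix (Fin n) (Fin j) ℂ) {c : Fin n → ℂ}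
    (hc : c ∉ LinearMap.range Z.mulVecLin) :
    ∃ L : Matrix (Fin 1) (Fin n) ℂ, L * Z = 0 ∧ L *ᵥ c = 1 := by
  obtain ⟨f, hf, hle⟩ := Submodule.exists_le_ker_of_notMem hc
  have hM : ∀ x, (LinearMap.toMatrix' (LinearMap.pi fun _ : Fin 1 => f)) *ᵥ x = fun _ => f x :=
    fun x => by
      rw [LinearMap.toMatrix'_mulVec]
      rfl
  refine ⟨(f c)⁻¹ • LinearMap.toMatrix' (LinearMap.pi fun _ : Fin 1 => f), ?_, ?_⟩
  · refine ext_of_mulVec_single fun i => ?_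
    have h0 : f (Z *ᵥ Pi.single i 1) = 0 := hle ⟨Pi.single i 1, rfl⟩
    rw [← mulVec_mulVec, smul_mulVec, hM, h0, zero_mulVec]
    exact smul_zero _
  · rw [smul_mulVec, hM]
    ext
    simp [hf]

end Rank

section Spectrum

variable {j : ℕ}

theorem mem_spectrum_iff_exists_mulVec_eq {M : Matrix (Fin j) (Fin j) ℂ} {μ : ℂ} :
    μ ∈ spectrum ℂ M ↔ ∃ w, w ≠ 0 ∧ M *ᵥ w = μ • w := by
  rw [spectrum.mem_iff, isUnit_iff_isUnit_det, isUnit_iff_ne_zero, not_not,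
    ← exists_mulVec_eq_zero_iff]
  refine exists_congr fun w => and_congr_right fun _ => ?_
  rw [sub_mulVec, sub_eq_zero, Algebra.algebraMap_eq_smul_one, smul_mulVec, one_mulVec, eq_comm]

theorem mem_spectrum_transpose {M : Matrix (Fin j) (Fin j) ℂ} {μ : ℂ} :
    μ ∈ spectrum ℂ Mᵀ ↔ μ ∈ spectrum ℂ M := by
  rw [mem_spectrum_iff_isRoot_charpoly, charpoly_transpose, ← mem_spectrum_iff_isRoot_charpoly]

/-- Every nonzero subspace invariant under a complex matrix contains an eigenvector. -/
theorem exists_eigenvector_mem {M : Matrix (Fin j) (Fin j) ℂ} {W : Submodule ℂ (Fin j → ℂ)}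
    (hW : W ≠ ⊥) (hM : ∀ w ∈ W, M *ᵥ w ∈ W) :
    ∃ w ∈ W, w ≠ 0 ∧ ∃ μ : ℂ, M *ᵥ w = μ • w := by
  have := (Submodule.nontrivial_iff_ne_bot).2 hW
  obtain ⟨μ, hμ⟩ := Module.End.exists_eigenvalue (M.mulVecLin.restrict hM)
  obtain ⟨w, hw⟩ := hμ.exists_hasEigenvector
  exact ⟨w, w.2, fun h => hw.2 (Subtype.ext h), μ, congrArg Subtype.val hw.apply_eq_smul⟩

/-- An intertwiner between matrices with disjoint spectra vanishes. -/
theorem eq_zero_of_mul_eq_mul {X H K : Matrix (Fin j) (Fin j) ℂ} (h : X * H = K * X)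
    (hd : ∀ s ∈ spectrum ℂ H, s ∉ spectrum ℂ K) : X = 0 := by
  rcases Nat.eq_zero_or_pos j with rfl | hj
  · exact Subsingleton.elim _ _
  have hp : ∀ p : ℂ[X], X * aeval H p = aeval K p * X := fun p => by
    induction p using Polynomial.induction_on' with
    | add p r hp hr => simp only [map_add, Matrix.mul_add, Matrix.add_mul, hp, hr]
    | monomial i a =>
      have hi : X * H ^ i = K ^ i * X := (show SemiconjBy X H K from h).pow_right i
      simp only [aeval_monomial, Algebra.algebraMap_eq_smul_one, smul_mul, Matrix.one_mul,
        Matrix.mul_smul, hi]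
  have hu : IsUnit (aeval K H.charpoly) := by
    rw [← spectrum.zero_notMem_iff ℂ, spectrum.map_polynomial_aeval_of_degree_pos]
    · rintro ⟨s, hs, h0⟩
      exact hd s (mem_spectrum_iff_isRoot_charpoly.2 h0) hs
    · rw [charpoly_degree_eq_dim]
      simpa using hj
  have h0 := hp H.charpoly
  rw [aeval_self_charpoly, Matrix.mul_zero] at h0
  exact (hu.mul_right_eq_zero).1 h0.symm

theorem neg_conj_mem_spectrum {H : Matrix (Fin j) (Fin j) ℂ} {s : ℂ}
    (hs : s ∈ spectrum ℂ (-Hᴴ)) : -(starRingEnd ℂ s) ∈ spectrum ℂ H := by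
  rw [← spectrum.neg_eq, Set.mem_neg, ← star_eq_conjTranspose, spectrum.map_star,
    Set.mem_star] at hs
  simpa using hs

end Spectrum

section Sylvester

variable {j l : ℕ}

theorem eq_zero_of_sylvester {X H : Matrix (Fin j) (Fin j) ℂ} (h : X * H + Hᴴ * X = 0)
    (hd : ∀ s ∈ spectrum ℂ H, -(starRingEnd ℂ s) ∉ spectrum ℂ H) : X = 0 := by
  refine eq_zero_of_mul_eq_mul (H := H) (K := -Hᴴ) ?_ fun s hs hs' =>
    hd s hs (neg_conj_mem_spectrum hs')
  rw [Matrix.neg_mul]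
  exact eq_neg_of_add_eq_zero_left h

theorem exists_sylvester {H : Matrix (Fin j) (Fin j) ℂ}
    (hd : ∀ s ∈ spectrum ℂ H, -(starRingEnd ℂ s) ∉ spectrum ℂ H) (Q : Matrix (Fin j) (Fin j) ℂ) :
    ∃ X, X * H + Hᴴ * X = Q := by
  have hinj : Function.Injective (LinearMap.mulRight ℂ H + LinearMap.mulLeft ℂ Hᴴ) :=
    (injective_iff_map_eq_zero _).2 fun X hX => eq_zero_of_sylvester hX hd
  exact LinearMap.surjective_of_injective hinj Q

/-- If the spectrum of `H` meets its reflection in the imaginary axis, the homogeneous Sylvester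
equation has a nonzero solution. -/
theorem exists_sylvester_ne_zero {H : Matrix (Fin j) (Fin j) ℂ} {s : ℂ} (hs : s ∈ spectrum ℂ H)
    (hs' : -(starRingEnd ℂ s) ∈ spectrum ℂ H) : ∃ X, X ≠ 0 ∧ X * H + Hᴴ * X = 0 := by
  obtain ⟨a, ha, hHa⟩ := mem_spectrum_iff_exists_mulVec_eq.1 (mem_spectrum_transpose.2 hs)
  obtain ⟨b, hb, hHb⟩ := mem_spectrum_iff_exists_mulVec_eq.1 (mem_spectrum_transpose.2 hs')
  refine ⟨vecMulVec (star b) a, ?_, ?_⟩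
  · rw [Ne, vecMulVec_eq_zero]
    simp [ha, hb]
  · have h1 : a ᵥ* H = s • a := by rw [← mulVec_transpose, hHa]
    have h2 : Hᴴ *ᵥ star b = -s • star b := by
      rw [← star_vecMul, ← mulVec_transpose, hHb]
      simp
    rw [vecMulVec_mul, mul_vecMulVec, h1, h2, vecMulVec_smul, smul_vecMulVec, neg_smul,
      add_neg_cancel]

open scoped ComplexOrder in
theorem mulVec_eq_zero_of_dotProduct_eq_zero {C : Matrix (Fin l) (Fin j) ℂ}
    {h : Matrix (Fin 1) (Fin j) ℂ} {w : Fin j → ℂ}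
    (hw : star w ⬝ᵥ ((Cᴴ * C + hᴴ * h) *ᵥ w) = 0) : C *ᵥ w = 0 ∧ h *ᵥ w = 0 := by
  rw [add_mulVec, dotProduct_add, ← mulVec_mulVec, ← mulVec_mulVec,
    dotProduct_mulVec (star w) Cᴴ, dotProduct_mulVec (star w) hᴴ, ← star_mulVec,
    ← star_mulVec] at hw
  rw [add_eq_zero_iff_of_nonneg (dotProduct_star_self_nonneg _)
    (dotProduct_star_self_nonneg _)] at hw
  exact ⟨dotProduct_star_self_eq_zero.1 hw.1, dotProduct_star_self_eq_zero.1 hw.2⟩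

/-- For an observable pair `(H, h)`, a solution of the Lyapunov equation is invertible. -/
theorem isUnit_of_sylvester {X H : Matrix (Fin j) (Fin j) ℂ} {C : Matrix (Fin l) (Fin j) ℂ}
    {h : Matrix (Fin 1) (Fin j) ℂ}
    (hd : ∀ s ∈ spectrum ℂ H, -(starRingEnd ℂ s) ∉ spectrum ℂ H)
    (hobs : ∀ (w : Fin j → ℂ) (μ : ℂ), H *ᵥ w = μ • w → h *ᵥ w = 0 → w = 0)
    (hX : X * H + Hᴴ * X = Cᴴ * C + hᴴ * h) : IsUnit X := by
  have hherm : Xᴴ = X := by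
    rw [← sub_eq_zero]
    refine eq_zero_of_sylvester (H := H) ?_ hd
    have h1 : Xᴴ * H + Hᴴ * Xᴴ = Cᴴ * C + hᴴ * h := by
      simpa [add_comm] using congrArg conjTranspose hX
    calc (Xᴴ - X) * H + Hᴴ * (Xᴴ - X) = (Xᴴ * H + Hᴴ * Xᴴ) - (X * H + Hᴴ * X) := by
          noncomm_ring
      _ = 0 := by rw [h1, hX, sub_self]
  have hker : ∀ w, X *ᵥ w = 0 → X *ᵥ (H *ᵥ w) = 0 ∧ h *ᵥ w = 0 := fun w hw => by
    have h0 : X *ᵥ (H *ᵥ w) = (Cᴴ * C + hᴴ * h) *ᵥ w := by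
      rw [← hX, add_mulVec, ← mulVec_mulVec, ← mulVec_mulVec, hw, mulVec_zero, add_zero]
    have h1 : star w ⬝ᵥ ((Cᴴ * C + hᴴ * h) *ᵥ w) = 0 := by
      rw [← h0, dotProduct_mulVec, ← hherm, ← star_mulVec, hw, star_zero, zero_dotProduct]
    obtain ⟨h2, h3⟩ := mulVec_eq_zero_of_dotProduct_eq_zero h1
    refine ⟨?_, h3⟩
    rw [h0, add_mulVec, ← mulVec_mulVec, ← mulVec_mulVec, h2, h3, mulVec_zero, mulVec_zero,
      add_zero]
  rw [← mulVec_injective_iff_isUnit]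
  change Function.Injective X.mulVecLin
  rw [← LinearMap.ker_eq_bot]
  by_contra hne
  obtain ⟨w, hw, hw0, μ, hμ⟩ := exists_eigenvector_mem (M := H) hne fun w hw => (hker w hw).1
  exact hw0 (hobs w μ hμ (hker w hw).2)

/-- An invertible matrix stays invertible along some nontrivial multiple of any perturbation. -/
theorem exists_isUnit_add_smul {X : Matrix (Fin j) (Fin j) ℂ} (hX : IsUnit X)
    (X₀ : Matrix (Fin j) (Fin j) ℂ) : ∃ t : ℂ, t ≠ 0 ∧ IsUnit (X + t • X₀) := by
  obtain ⟨μ, hμ⟩ := ((finite_spectrum (X⁻¹ * X₀)).insert 0).exists_notMem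
  rw [Set.mem_insert_iff, not_or, spectrum.notMem_iff] at hμ
  obtain ⟨h0, hu⟩ := hμ
  refine ⟨-μ⁻¹, by simpa using h0, ?_⟩
  have h1 : X + -μ⁻¹ • X₀ = X * (μ⁻¹ • (algebraMap ℂ _ μ - X⁻¹ * X₀)) := by
    rw [Algebra.algebraMap_eq_smul_one, smul_sub, smul_smul, inv_mul_cancel₀ h0, one_smul,
      Matrix.mul_sub, Matrix.mul_one, Matrix.mul_smul, ← Matrix.mul_assoc,
      mul_nonsing_inv _ ((isUnit_iff_isUnit_det X).1 hX), Matrix.one_mul, neg_smul, sub_eq_add_neg]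
  rw [h1]
  exact hX.mul (hu.smul (Units.mk0 _ (inv_ne_zero h0)))

end Sylvester

end Matrix

section Krylov

variable {n j : ℕ}

/-- The linear map `p ↦ p(F) v`. -/
noncomputable def krylovMap (F : Matrix (Fin n) (Fin n) ℂ) (v : Fin n → ℂ) :
    ℂ[X] →ₗ[ℂ] (Fin n → ℂ) where
  toFun p := aeval F p *ᵥ v
  map_add' p r := by rw [map_add, add_mulVec]
  map_smul' a p := by rw [map_smul, smul_mulVec, RingHom.id_apply]

theorem krylovMap_mul (F : Matrix (Fin n) (Fin n) ℂ) (v : Fin n → ℂ) (p r : ℂ[X]) :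
    krylovMap F v (p * r) = aeval F p *ᵥ krylovMap F v r := by
  simp [krylovMap, mulVec_mulVec]

theorem krylovMap_X_mul (F : Matrix (Fin n) (Fin n) ℂ) (v : Fin n → ℂ) (p : ℂ[X]) :
    krylovMap F v (X * p) = F *ᵥ krylovMap F v p := by
  rw [krylovMap_mul, aeval_X]

theorem polyKrylov_eq_map (F : Matrix (Fin n) (Fin n) ℂ) (b : Fin n → ℂ) :
    polyKrylov F b j = (degreeLT ℂ j).map (krylovMap F b) := by
  rw [degreeLT_eq_span_X_pow, Submodule.map_span, polyKrylov]
  congr 1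
  ext x
  simp [krylovMap, eq_comm]

variable {F : Matrix (Fin n) (Fin n) ℂ} {c : Fin n → ℂ} {q : ℂ[X]}

theorem ratKrylov_eq_map (hinv : IsUnit (aeval F q)) :
    ratKrylov F c j q = (degreeLT ℂ j).map (krylovMap F ((aeval F q)⁻¹ *ᵥ c)) := by
  rw [ratKrylov, polyKrylov_eq_map, ← Submodule.map_comp]
  congr 1
  refine LinearMap.ext fun p => ?_
  have hcomm : (aeval F q)⁻¹ * aeval F p = aeval F p * (aeval F q)⁻¹ := by
    have h := (isUnit_iff_isUnit_det _).1 hinv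
    have hpq : aeval F p * aeval F q = aeval F q * aeval F p := by
      rw [← map_mul, mul_comm, map_mul]
    calc (aeval F q)⁻¹ * aeval F p
        = (aeval F q)⁻¹ * (aeval F p * aeval F q) * (aeval F q)⁻¹ := by
          rw [Matrix.mul_assoc, Matrix.mul_assoc, mul_nonsing_inv _ h, Matrix.mul_one]
      _ = aeval F p * (aeval F q)⁻¹ := by
          rw [hpq, ← Matrix.mul_assoc, nonsing_inv_mul _ h, Matrix.one_mul]
  simp [krylovMap, mulVec_mulVec, hcomm]

theorem krylovMap_denominator (hinv : IsUnit (aeval F q)) :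
    krylovMap F ((aeval F q)⁻¹ *ᵥ c) q = c := by
  simp [krylovMap, mulVec_mulVec, mul_nonsing_inv _ ((isUnit_iff_isUnit_det _).1 hinv)]

/-- If the image of the polynomials of degree `< j` has full dimension and is not invariant, then
`p ↦ p(F) v` is injective on polynomials of degree `≤ j`. -/
theorem eq_zero_of_krylovMap_eq_zero {v : Fin n → ℂ}
    (hdim : Module.finrank ℂ ((degreeLT ℂ j).map (krylovMap F v)) = j)
    (hvar : ¬ ((degreeLT ℂ j).map (krylovMap F v)).map F.mulVecLin ≤
      (degreeLT ℂ j).map (krylovMap F v))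
    {p : ℂ[X]} (hp : p.degree ≤ j) (h0 : krylovMap F v p = 0) : p = 0 := by
  by_contra hne
  rcases hp.lt_or_eq with hlt | heq
  · have hfin : Module.finrank ℂ (degreeLT ℂ j) = j := by
      simpa using (degreeLTEquiv ℂ j).finrank_eq
    have hinj : Function.Injective ((krylovMap F v).domRestrict (degreeLT ℂ j)) := by
      rw [← LinearMap.ker_eq_bot, ← Submodule.finrank_eq_zero (R := ℂ)]
      have : Module.Finite ℂ (degreeLT ℂ j) := Module.Finite.equiv (degreeLTEquiv ℂ j).symm
      have h := LinearMap.finrank_range_add_finrank_ker ((krylovMap F v).domRestrict (degreeLT ℂ j))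
      rw [LinearMap.range_domRestrict, hdim, hfin] at h
      omega
    have := @hinj ⟨p, mem_degreeLT.2 hlt⟩ 0 (by simpa using h0)
    exact hne (congrArg Subtype.val this)
  · refine hvar ?_
    rintro _ ⟨_, ⟨r, hr, rfl⟩, rfl⟩
    refine ⟨X * r % p, mem_degreeLT.2 (heq ▸ degree_mod_lt _ hne), ?_⟩
    have h := congrArg (krylovMap F v) (EuclideanDomain.div_add_mod (X * r) p)
    rw [map_add, mul_comm p, krylovMap_mul, h0, mulVec_zero, zero_add, krylovMap_X_mul] at h
    exact h

end Krylov

section Residual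

variable {n m j : ℕ} {F : Matrix (Fin n) (Fin n) ℂ} {B : Matrix (Fin n) (Fin m) ℂ}
  {c : Fin n → ℂ} {Z : Matrix (Fin n) (Fin j) ℂ}

theorem mul_colMat (L : Matrix (Fin 1) (Fin n) ℂ) (c : Fin n → ℂ) :
    L * colMat c = of fun i _ => (L *ᵥ c) i := by
  ext a b
  simp [mul_apply, colMat, mulVec, dotProduct]

theorem colMat_mulVec (c : Fin n → ℂ) (x : Fin 1 → ℂ) : colMat c *ᵥ x = x 0 • c := by
  ext r
  simp [colMat, mulVec, dotProduct, mul_comm]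

theorem vecMulVec_star_self (c : Fin n → ℂ) : vecMulVec c (star c) = colMat c * (colMat c)ᴴ := by
  ext a b
  simp [mul_apply, colMat, vecMulVec_apply]

/-- No invertible `Y` gives a residual of rank one if `c` lies in the non-invariant column space
of `Z`. -/
theorem rank_residual_ne_one (hZ : Function.Injective Z.mulVec)
    (hc : c ∈ LinearMap.range Z.mulVecLin)
    (hvar : ¬ (LinearMap.range Z.mulVecLin).map F.mulVecLin ≤ LinearMap.range Z.mulVecLin)
    {Y : Matrix (Fin j) (Fin j) ℂ} (hY : IsUnit Y) :
    (F * (Z * Y * Zᴴ) + (Z * Y * Zᴴ) * Fᴴ + vecMulVec c (star c)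
      - (Z * Y * Zᴴ) * B * Bᴴ * (Z * Y * Zᴴ)).rank ≠ 1 := by
  intro hR
  obtain ⟨_, ⟨_, ⟨w, rfl⟩, rfl⟩, hw⟩ := Set.not_subset.1 hvar
  obtain ⟨L, hLZ, hLw⟩ := exists_row_of_notMem_range Z hw
  have hZL : Zᴴ * Lᴴ = 0 := by rw [← conjTranspose_mul, hLZ, conjTranspose_zero]
  have hLc : L * colMat c = 0 := by
    obtain ⟨y, rfl⟩ := hc
    rw [mul_colMat, mulVecLin_apply, mulVec_mulVec, hLZ, zero_mulVec]
    rfl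
  have hcL : (colMat c)ᴴ * Lᴴ = 0 := by rw [← conjTranspose_mul, hLc, conjTranspose_zero]
  have hLFZ : L * F * Z ≠ 0 := fun h0 => by
    rw [mulVecLin_apply, mulVecLin_apply, mulVec_mulVec, mulVec_mulVec, h0, zero_mulVec] at hLw
    exact zero_ne_one (congrFun hLw 0)
  have hYdet := (isUnit_iff_isUnit_det Y).1 hY
  have hLR : L * (F * (Z * Y * Zᴴ) + (Z * Y * Zᴴ) * Fᴴ + vecMulVec c (star c)
      - (Z * Y * Zᴴ) * B * Bᴴ * (Z * Y * Zᴴ)) = L * F * Z * Y * Zᴴ := by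
    simp only [Matrix.mul_add, Matrix.mul_sub, ← Matrix.mul_assoc, hLZ, hLc, vecMulVec_star_self,
      Matrix.zero_mul, add_zero, sub_zero]
  have hRL : (F * (Z * Y * Zᴴ) + (Z * Y * Zᴴ) * Fᴴ + vecMulVec c (star c)
      - (Z * Y * Zᴴ) * B * Bᴴ * (Z * Y * Zᴴ)) * Lᴴ = Z * (Y * (L * F * Z)ᴴ) := by
    simp only [Matrix.add_mul, Matrix.sub_mul, Matrix.mul_assoc, hZL, hcL, vecMulVec_star_self,
      Matrix.mul_zero, add_zero, sub_zero, zero_add, conjTranspose_mul]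
  have h0 : L * (F * (Z * Y * Zᴴ) + (Z * Y * Zᴴ) * Fᴴ + vecMulVec c (star c)
      - (Z * Y * Zᴴ) * B * Bᴴ * (Z * Y * Zᴴ)) * Lᴴ = 0 := by
    rw [hLR, Matrix.mul_assoc, hZL, Matrix.mul_zero]
  rcases mul_eq_zero_or_of_rank_eq_one hR h0 with h | h
  · rw [hLR] at h
    have h1 := eq_zero_of_mul_conjTranspose_eq_zero hZ h
    refine hLFZ ?_
    rw [← mul_nonsing_inv_cancel_right Y (L * F * Z) hYdet, h1, Matrix.zero_mul]
  · rw [hRL] at h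
    have h1 := eq_zero_of_mul_eq_zero hZ h
    refine hLFZ (conjTranspose_eq_zero.1 ?_)
    rw [← nonsing_inv_mul_cancel_left Y (L * F * Z)ᴴ hYdet, h1, Matrix.mul_zero]

/-- If `F Z = c h + Z H` with `c` outside the column space of `Z`, the residual has rank one exactly
when the inverse of `Y` solves a Sylvester equation. -/
theorem rank_residual_eq_one_iff (hZ : Function.Injective Z.mulVec)
    (hc : c ∉ LinearMap.range Z.mulVecLin) {h : Matrix (Fin 1) (Fin j) ℂ}
    {H : Matrix (Fin j) (Fin j) ℂ} (hF : F * Z = colMat c * h + Z * H)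
    {Y : Matrix (Fin j) (Fin j) ℂ} (hY : IsUnit Y) :
    (F * (Z * Y * Zᴴ) + (Z * Y * Zᴴ) * Fᴴ + vecMulVec c (star c)
      - (Z * Y * Zᴴ) * B * Bᴴ * (Z * Y * Zᴴ)).rank = 1 ↔
    Y⁻¹ * H + Hᴴ * Y⁻¹ = Zᴴ * B * Bᴴ * Z + hᴴ * h := by
  have hYdet := (isUnit_iff_isUnit_det Y).1 hY
  obtain ⟨L, hLZ, hLc⟩ := exists_row_of_notMem_range Z hc
  have hZL : Zᴴ * Lᴴ = 0 := by rw [← conjTranspose_mul, hLZ, conjTranspose_zero]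
  replace hLc : L * colMat c = 1 := by
    rw [mul_colMat, hLc]
    ext a b
    fin_cases a; fin_cases b
    rfl
  have hcL : (colMat c)ᴴ * Lᴴ = 1 := by rw [← conjTranspose_mul, hLc, conjTranspose_one]
  have hF' : Zᴴ * Fᴴ = hᴴ * (colMat c)ᴴ + Hᴴ * Zᴴ := by
    rw [← conjTranspose_mul, hF, conjTranspose_add, conjTranspose_mul, conjTranspose_mul]
  set u := colMat c + Z * (Y * hᴴ) with hu
  set w := (colMat c)ᴴ + h * Y * Zᴴ with hw
  set K := H * Y + Y * Hᴴ - Y * (Zᴴ * B * Bᴴ * Z + hᴴ * h) * Y with hK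
  have hLu : L * u = 1 := by
    rw [hu, Matrix.mul_add, ← Matrix.mul_assoc, hLZ, hLc, Matrix.zero_mul, add_zero]
  have hwL : w * Lᴴ = 1 := by
    rw [hw, Matrix.add_mul, Matrix.mul_assoc, hZL, hcL, Matrix.mul_zero, add_zero]
  have hR : F * (Z * Y * Zᴴ) + (Z * Y * Zᴴ) * Fᴴ + vecMulVec c (star c)
      - (Z * Y * Zᴴ) * B * Bᴴ * (Z * Y * Zᴴ) = u * w + Z * K * Zᴴ := by
    have h1 : F * (Z * Y * Zᴴ) = (colMat c * h + Z * H) * Y * Zᴴ := by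
      rw [← hF]
      simp only [Matrix.mul_assoc]
    have h2 : Z * Y * Zᴴ * Fᴴ = Z * Y * (hᴴ * (colMat c)ᴴ + Hᴴ * Zᴴ) := by
      rw [← hF', Matrix.mul_assoc]
    rw [h1, h2, vecMulVec_star_self, hu, hw, hK]
    simp only [Matrix.mul_add, Matrix.add_mul, Matrix.mul_sub, Matrix.sub_mul, Matrix.mul_assoc]
    abel
  have hKX : K = 0 ↔ Y⁻¹ * H + Hᴴ * Y⁻¹ = Zᴴ * B * Bᴴ * Z + hᴴ * h := by
    have h1 : K = Y * (Y⁻¹ * H + Hᴴ * Y⁻¹ - (Zᴴ * B * Bᴴ * Z + hᴴ * h)) * Y := by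
      rw [hK, Matrix.mul_sub, Matrix.sub_mul, Matrix.mul_add Y (Y⁻¹ * H),
        mul_nonsing_inv_cancel_left _ _ hYdet, ← Matrix.mul_assoc Y Hᴴ, Matrix.add_mul,
        nonsing_inv_mul_cancel_right _ _ hYdet]
    rw [h1, hY.mul_left_eq_zero, hY.mul_right_eq_zero, sub_eq_zero]
  rw [hR, ← hKX]
  constructor
  · intro hrank
    have h1 : L * (u * w + Z * K * Zᴴ) = w := by
      rw [Matrix.mul_add, ← Matrix.mul_assoc, hLu, Matrix.one_mul, Matrix.mul_assoc Z,
        ← Matrix.mul_assoc, hLZ, Matrix.zero_mul, add_zero]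
    have h2 : (u * w + Z * K * Zᴴ) * Lᴴ = u := by
      rw [Matrix.add_mul, Matrix.mul_assoc, hwL, Matrix.mul_one, Matrix.mul_assoc (Z * K), hZL,
        Matrix.mul_zero, add_zero]
    have h3 := mul_mul_eq_self_of_rank_eq_one hrank (L := L) (L' := Lᴴ) (by rw [h1, hwL])
    rw [h1, h2] at h3
    have h4 : Z * K * Zᴴ = 0 := by simpa using h3
    exact eq_zero_of_mul_eq_zero hZ (eq_zero_of_mul_conjTranspose_eq_zero hZ h4)
  · intro hK0
    rw [hK0, Matrix.mul_zero, Matrix.zero_mul, add_zero]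
    refine rank_mul_eq_one fun h0 => ?_
    have h1 : L * (u * w) * Lᴴ = 1 := by
      rw [← Matrix.mul_assoc, hLu, Matrix.one_mul, hwL]
    rw [h0, Matrix.mul_zero, Matrix.zero_mul] at h1
    exact zero_ne_one (congrFun (congrFun h1 0) 0)

end Residual

section Arnoldi

variable {n j : ℕ} {F : Matrix (Fin n) (Fin n) ℂ} {c v : Fin n → ℂ} {Z : Matrix (Fin n) (Fin j) ℂ}
  {q : ℂ[X]}

theorem krylovMap_denominator_notMem
    (hrange : LinearMap.range Z.mulVecLin = (degreeLT ℂ j).map (krylovMap F v))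
    (hinj : ∀ p : ℂ[X], p.degree ≤ j → krylovMap F v p = 0 → p = 0)
    (hqc : krylovMap F v q = c) (hq : q.degree = j) : c ∉ LinearMap.range Z.mulVecLin := by
  rw [hrange]
  rintro ⟨p, hp, hpc⟩
  have hp' : p.degree < q.degree := hq ▸ mem_degreeLT.1 hp
  have h := hinj (p - q) ((degree_sub_eq_right_of_degree_lt hp').trans hq).le
    (by rw [map_sub, hpc, hqc, sub_self])
  rw [sub_eq_zero.1 h] at hp'
  exact lt_irrefl _ hp'

theorem exists_arnoldi (hrange : LinearMap.range Z.mulVecLin = (degreeLT ℂ j).map (krylovMap F v))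
    (hqc : krylovMap F v q = c) (hqm : q.Monic) (hq : q.degree = j) :
    ∃ (h : Matrix (Fin 1) (Fin j) ℂ) (H : Matrix (Fin j) (Fin j) ℂ),
      F * Z = colMat c * h + Z * H := by
  have key : ∀ i : Fin j, ∃ (a : ℂ) (w : Fin j → ℂ),
      (F * Z) *ᵥ Pi.single i 1 = a • c + Z *ᵥ w := fun i => by
    have hi : Z *ᵥ Pi.single i 1 ∈ LinearMap.range Z.mulVecLin := ⟨_, rfl⟩
    rw [hrange] at hi
    obtain ⟨p, hp, hpi⟩ := hi
    have hmod : krylovMap F v (X * p %ₘ q) ∈ LinearMap.range Z.mulVecLin := by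
      rw [hrange]
      exact ⟨_, mem_degreeLT.2 (hq ▸ degree_modByMonic_lt _ hqm), rfl⟩
    obtain ⟨w, hw⟩ := hmod
    have hdeg : (X * p /ₘ q).natDegree = 0 := by
      have h1 : (X * p).natDegree ≤ j := by
        rcases eq_or_ne p 0 with rfl | hp0
        · simp
        · rw [natDegree_X_mul hp0]
          exact (natDegree_lt_iff_degree_lt hp0).2 (mem_degreeLT.1 hp)
      rw [natDegree_divByMonic _ hqm, natDegree_eq_of_degree_eq_some hq]
      omega
    refine ⟨(X * p /ₘ q).coeff 0, w, ?_⟩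
    have h2 := congrArg (krylovMap F v) (modByMonic_add_div (X * p) q)
    rw [map_add, mul_comm q, eq_C_of_natDegree_eq_zero hdeg, ← smul_eq_C_mul, map_smul, hqc,
      krylovMap_X_mul, hpi, ← hw] at h2
    rw [← mulVec_mulVec, ← h2, add_comm]
    rfl
  choose a w haw using key
  refine ⟨of fun _ i => a i, of fun r i => w i r, ext_of_mulVec_single fun i => ?_⟩
  rw [haw, add_mulVec, ← mulVec_mulVec, ← mulVec_mulVec, colMat_mulVec]
  congr 2
  · simp
  · ext
    simp

variable {h : Matrix (Fin 1) (Fin j) ℂ} {H : Matrix (Fin j) (Fin j) ℂ}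

theorem arnoldi_mulVec (hF : F * Z = colMat c * h + Z * H) (w : Fin j → ℂ) :
    F *ᵥ (Z *ᵥ w) = (h *ᵥ w) 0 • c + Z *ᵥ (H *ᵥ w) := by
  rw [mulVec_mulVec, hF, add_mulVec, ← mulVec_mulVec, ← mulVec_mulVec, colMat_mulVec]

/-- An eigenvector `w` of the Arnoldi matrix corresponds to a polynomial `p` with
`(X - μ) p = (h w) q`. -/
theorem exists_poly_of_eigenvector
    (hrange : LinearMap.range Z.mulVecLin = (degreeLT ℂ j).map (krylovMap F v))
    (hinj : ∀ p : ℂ[X], p.degree ≤ j → krylovMap F v p = 0 → p = 0)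
    (hqc : krylovMap F v q = c) (hq : q.degree = j) (hF : F * Z = colMat c * h + Z * H)
    {w : Fin j → ℂ} {μ : ℂ} (hw : H *ᵥ w = μ • w) :
    ∃ p : ℂ[X], krylovMap F v p = Z *ᵥ w ∧ (X - C μ) * p = C ((h *ᵥ w) 0) * q := by
  have hi : Z *ᵥ w ∈ LinearMap.range Z.mulVecLin := ⟨_, rfl⟩
  rw [hrange] at hi
  obtain ⟨p, hp, hpw⟩ := hi
  refine ⟨p, hpw, ?_⟩
  rw [← sub_eq_zero]
  refine hinj _ ?_ ?_
  · refine (degree_sub_le _ _).trans (max_le ?_ ?_)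
    · rcases eq_or_ne p 0 with rfl | hp0
      · simp
      · have h1 := (natDegree_lt_iff_degree_lt hp0).2 (mem_degreeLT.1 hp)
        rw [← natDegree_le_iff_degree_le, natDegree_mul (X_sub_C_ne_zero μ) hp0, natDegree_X_sub_C]
        omega
    · rw [← smul_eq_C_mul]
      exact (degree_smul_le _ _).trans hq.le
  · have h2 := arnoldi_mulVec hF w
    rw [hw, ← hpw, ← krylovMap_X_mul, mulVec_smul, ← hpw] at h2
    rw [sub_mul, map_sub, map_sub, ← smul_eq_C_mul, ← smul_eq_C_mul, map_smul, map_smul, hqc, h2]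
    abel

theorem arnoldi_observable (hZ : Function.Injective Z.mulVec)
    (hrange : LinearMap.range Z.mulVecLin = (degreeLT ℂ j).map (krylovMap F v))
    (hinj : ∀ p : ℂ[X], p.degree ≤ j → krylovMap F v p = 0 → p = 0)
    (hqc : krylovMap F v q = c) (hq : q.degree = j) (hF : F * Z = colMat c * h + Z * H)
    (w : Fin j → ℂ) (μ : ℂ) (hw : H *ᵥ w = μ • w) (hhw : h *ᵥ w = 0) : w = 0 := by
  obtain ⟨p, hpw, hp⟩ := exists_poly_of_eigenvector hrange hinj hqc hq hF hw
  rw [hhw, Pi.zero_apply, C_0, zero_mul, mul_eq_zero, or_iff_right (X_sub_C_ne_zero μ)] at hp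
  refine hZ ?_
  rw [← hpw, hp, map_zero, mulVec_zero]

/-- The eigenvalues of the Arnoldi matrix are the poles of the rational Krylov subspace. -/
theorem mem_spectrum_arnoldi_iff (hZ : Function.Injective Z.mulVec)
    (hrange : LinearMap.range Z.mulVecLin = (degreeLT ℂ j).map (krylovMap F v))
    (hinj : ∀ p : ℂ[X], p.degree ≤ j → krylovMap F v p = 0 → p = 0)
    (hqc : krylovMap F v q = c) (hq : q.degree = j) (hF : F * Z = colMat c * h + Z * H) {μ : ℂ} :
    μ ∈ spectrum ℂ H ↔ q.IsRoot μ := by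
  constructor
  · intro hμ
    obtain ⟨w, hw0, hw⟩ := mem_spectrum_iff_exists_mulVec_eq.1 hμ
    have hhw : (h *ᵥ w) 0 ≠ 0 := fun h0 =>
      hw0 (arnoldi_observable hZ hrange hinj hqc hq hF w μ hw (by ext i; fin_cases i; exact h0))
    obtain ⟨p, -, hp⟩ := exists_poly_of_eigenvector hrange hinj hqc hq hF hw
    have h1 := congrArg (eval μ) hp
    simpa [hhw] using h1.symm
  · intro hμ
    have hc := krylovMap_denominator_notMem hrange hinj hqc hq
    obtain ⟨p, rfl⟩ := dvd_iff_isRoot.2 hμ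
    have hp0 : p ≠ 0 := by
      rintro rfl
      simp at hq
    have hp : p ∈ degreeLT ℂ j := by
      have h1 := natDegree_eq_of_degree_eq_some hq
      rw [natDegree_mul (X_sub_C_ne_zero μ) hp0, natDegree_X_sub_C] at h1
      exact mem_degreeLT.2 ((natDegree_lt_iff_degree_lt hp0).1 (by omega))
    have hpr : krylovMap F v p ∈ LinearMap.range Z.mulVecLin := hrange ▸ ⟨p, hp, rfl⟩
    obtain ⟨w, hw⟩ := hpr
    rw [mulVecLin_apply] at hw
    have h2 := arnoldi_mulVec hF w
    have h3 : F *ᵥ (Z *ᵥ w) = c + μ • Z *ᵥ w := by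
      rw [← hqc, sub_mul, map_sub, krylovMap_X_mul, ← smul_eq_C_mul, map_smul, hw]
      abel
    have h4 : (1 - (h *ᵥ w) 0) • c = Z *ᵥ (H *ᵥ w - μ • w) := by
      rw [mulVec_sub, mulVec_smul, sub_smul, one_smul, sub_eq_sub_iff_add_eq_add, ← h3, h2,
        add_comm]
    have h5 : 1 - (h *ᵥ w) 0 = 0 := by
      by_contra hne
      refine hc ?_
      rw [← Submodule.smul_mem_iff _ hne, h4]
      exact ⟨_, rfl⟩
    refine mem_spectrum_iff_exists_mulVec_eq.2 ⟨w, ?_, ?_⟩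
    · rintro rfl
      simp at h5
    · rw [← sub_eq_zero]
      refine hZ ?_
      rw [← h4, h5, zero_smul, mulVec_zero]

end Arnoldi

theorem stmt1 {n m j : ℕ} (hj : 1 ≤ j)
    (A : Matrix (Fin n) (Fin n) ℂ) (B : Matrix (Fin n) (Fin m) ℂ)
    (c : Fin n → ℂ) (hc : c ≠ 0)
    (q : Polynomial ℂ) (hq : q.Monic) (k : ℕ) (hk : q.natDegree = k) (hkj : k ≤ j)
    (hinv : IsUnit (aeval Aᴴ q))
    (hvar : ¬ (ratKrylov Aᴴ c j q).map Aᴴ.mulVecLin ≤ ratKrylov Aᴴ c j q)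
    (hdim : Module.finrank ℂ (ratKrylov Aᴴ c j q) = j)
    (Z : Matrix (Fin n) (Fin j) ℂ)
    (hZli : LinearIndependent ℂ (fun i => Zᵀ i))
    (hZspan : Submodule.span ℂ (Set.range fun i => Zᵀ i) = ratKrylov Aᴴ c j q) :
    ((∃! Y : Matrix (Fin j) (Fin j) ℂ, IsUnit Y ∧
        (Aᴴ * (Z * Y * Zᴴ) + (Z * Y * Zᴴ) * A + Matrix.vecMulVec c (star c)
          - (Z * Y * Zᴴ) * B * Bᴴ * (Z * Y * Zᴴ)).rank = 1)
      ↔ (k = j ∧ ∀ s : ℂ, q.IsRoot s → ¬ q.IsRoot (-(starRingEnd ℂ s)))) ∧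
    (∀ (Y : Matrix (Fin j) (Fin j) ℂ) (h : Matrix (Fin 1) (Fin j) ℂ)
        (H : Matrix (Fin j) (Fin j) ℂ),
      (k = j ∧ ∀ s : ℂ, q.IsRoot s → ¬ q.IsRoot (-(starRingEnd ℂ s))) →
      IsUnit Y →
      (Aᴴ * (Z * Y * Zᴴ) + (Z * Y * Zᴴ) * A + Matrix.vecMulVec c (star c)
          - (Z * Y * Zᴴ) * B * Bᴴ * (Z * Y * Zᴴ)).rank = 1 →
      Aᴴ * Z = colMat c * h + Z * H →
      Y⁻¹ * H + Hᴴ * Y⁻¹ = Zᴴ * B * Bᴴ * Z + hᴴ * h) := by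
  have hZ : Function.Injective Z.mulVec := mulVec_injective_iff.2 hZli
  have hrange : LinearMap.range Z.mulVecLin = ratKrylov Aᴴ c j q := by
    rw [range_mulVecLin]
    exact hZspan
  rw [ratKrylov_eq_map hinv] at hvar hdim
  have hinj : ∀ p : ℂ[X], p.degree ≤ j →
      krylovMap Aᴴ ((aeval Aᴴ q)⁻¹ *ᵥ c) p = 0 → p = 0 := fun p =>
    eq_zero_of_krylovMap_eq_zero hdim hvar
  have hqc := krylovMap_denominator (c := c) hinv
  rw [ratKrylov_eq_map hinv] at hrange
  have hfull : k = j → q.degree = j := fun hkj => by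
    rw [degree_eq_natDegree hq.ne_zero, hk, hkj]
  have hrank : ∀ {Y : Matrix (Fin j) (Fin j) ℂ} {h : Matrix (Fin 1) (Fin j) ℂ}
      {H : Matrix (Fin j) (Fin j) ℂ}, k = j → IsUnit Y → Aᴴ * Z = colMat c * h + Z * H → _ :=
    fun hkj hY hF => rank_residual_eq_one_iff (B := B) hZ
      (krylovMap_denominator_notMem hrange hinj hqc (hfull hkj)) hF hY
  simp only [conjTranspose_conjTranspose] at hrank
  refine ⟨⟨?_, ?_⟩, fun Y h H hq' hY hYrank hF => (hrank hq'.1 hY hF).1 hYrank⟩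
  · rintro ⟨Y, ⟨hY, hYrank⟩, hYuniq⟩
    have hkj' : k = j := by
      by_contra hne
      have hc : c ∈ LinearMap.range Z.mulVecLin := by
        rw [hrange]
        refine ⟨q, mem_degreeLT.2 ?_, hqc⟩
        rw [← natDegree_lt_iff_degree_lt hq.ne_zero, hk]
        omega
      rw [← hrange] at hvar
      have h1 := rank_residual_ne_one (B := B) hZ hc hvar hY
      rw [conjTranspose_conjTranspose] at h1
      exact h1 hYrank
    refine ⟨hkj', fun s hs hs' => ?_⟩
    obtain ⟨h, H, hF⟩ := exists_arnoldi hrange hqc hq (hfull hkj')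
    have hspec : ∀ {μ : ℂ}, μ ∈ spectrum ℂ H ↔ q.IsRoot μ :=
      mem_spectrum_arnoldi_iff hZ hrange hinj hqc (hfull hkj') hF
    obtain ⟨X₀, hX₀, hX₀eq⟩ := exists_sylvester_ne_zero (hspec.2 hs) (hspec.2 hs')
    have hYinv : IsUnit Y⁻¹ := (isUnit_nonsing_inv_iff).2 hY
    obtain ⟨t, ht, hu⟩ := exists_isUnit_add_smul hYinv X₀
    have hYeq := (hrank hkj' hY hF).1 hYrank
    have hu' := (isUnit_nonsing_inv_iff).2 hu
    have h1 : (Y⁻¹ + t • X₀)⁻¹ = Y := by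
      refine hYuniq _ ⟨hu', (hrank hkj' hu' hF).2 ?_⟩
      rw [nonsing_inv_nonsing_inv _ ((isUnit_iff_isUnit_det _).1 hu), ← hYeq, Matrix.add_mul,
        Matrix.mul_add, smul_mul, Matrix.mul_smul, add_add_add_comm, ← smul_add, hX₀eq, smul_zero,
        add_zero]
    have h2 : Y⁻¹ + t • X₀ = Y⁻¹ :=
      (nonsing_inv_nonsing_inv _ ((isUnit_iff_isUnit_det _).1 hu)).symm.trans
        (congrArg (fun M => M⁻¹) h1)
    rw [add_eq_left, smul_eq_zero] at h2
    exact h2.elim ht hX₀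
  · rintro ⟨hkj', hroot⟩
    obtain ⟨h, H, hF⟩ := exists_arnoldi hrange hqc hq (hfull hkj')
    have hspec : ∀ {μ : ℂ}, μ ∈ spectrum ℂ H ↔ q.IsRoot μ :=
      mem_spectrum_arnoldi_iff hZ hrange hinj hqc (hfull hkj') hF
    have hd : ∀ s ∈ spectrum ℂ H, -(starRingEnd ℂ s) ∉ spectrum ℂ H := fun s hs hs' =>
      hroot s (hspec.1 hs) (hspec.1 hs')
    obtain ⟨X, hX⟩ := exists_sylvester hd (Zᴴ * B * Bᴴ * Z + hᴴ * h)
    have hXu : IsUnit X := by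
      refine isUnit_of_sylvester (C := Bᴴ * Z) (h := h) hd
        (arnoldi_observable hZ hrange hinj hqc (hfull hkj') hF) ?_
      rw [hX, conjTranspose_mul, conjTranspose_conjTranspose]
      simp only [Matrix.mul_assoc]
    have hXinv := (isUnit_nonsing_inv_iff).2 hXu
    have hXX := nonsing_inv_nonsing_inv X ((isUnit_iff_isUnit_det _).1 hXu)
    refine ⟨X⁻¹, ⟨hXinv, (hrank hkj' hXinv hF).2 (by rw [hXX, hX])⟩, ?_⟩
    rintro Y ⟨hY, hYrank⟩
    have hYeq := (hrank hkj' hY hF).1 hYrank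
    have h1 : Y⁻¹ - X = 0 := by
      refine eq_zero_of_sylvester (H := H) ?_ hd
      rw [Matrix.sub_mul, Matrix.mul_sub, sub_add_sub_comm, hYeq, hX, sub_self]
    rw [← sub_eq_zero.1 h1, nonsing_inv_nonsing_inv _ ((isUnit_iff_isUnit_det _).1 hY)]
end

section
/- Let A ∈ ℂ^{n×n}, B ∈ ℂ^{n×m}, C ∈ ℂ^{p×n}. Let Z ∈ ℂ^{n×k} have full column rank, and let h ∈ ℂ^{p×k}, H ∈ ℂ^{k×k} satisfy A*Z = C*h + Z·H. Let Y ∈ ℂ^{k×k}, set X = ZYZ* and R = C* + ZYh*. Suppose W̃ ∈ ℂ^{n×k} satisfies W̃*Z = I_k and W̃*R = 0, and set Π = Z·W̃*. Then Π·𝓡(X)·Π* = 0 if and only if H·Y + Y·H* − Y·(Z*BB*Z + h*h)·Y = 0. -/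
open Matrix

theorem stmt2 {n m p k : ℕ}
    (A : Matrix (Fin n) (Fin n) ℂ) (B : Matrix (Fin n) (Fin m) ℂ)
    (C : Matrix (Fin p) (Fin n) ℂ)
    (Z : Matrix (Fin n) (Fin k) ℂ) (hZ : LinearIndependent ℂ (fun i => Zᵀ i))
    (h : Matrix (Fin p) (Fin k) ℂ) (H : Matrix (Fin k) (Fin k) ℂ)
    (hRAD : Aᴴ * Z = Cᴴ * h + Z * H)
    (Y : Matrix (Fin k) (Fin k) ℂ)
    (W : Matrix (Fin n) (Fin k) ℂ)
    (hWZ : Wᴴ * Z = 1) (hWR : Wᴴ * (Cᴴ + Z * Y * hᴴ) = 0) :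
    (Z * Wᴴ) * (Aᴴ * (Z * Y * Zᴴ) + (Z * Y * Zᴴ) * A + Cᴴ * C
        - (Z * Y * Zᴴ) * B * Bᴴ * (Z * Y * Zᴴ)) * (Z * Wᴴ)ᴴ = 0
      ↔ H * Y + Y * Hᴴ - Y * (Zᴴ * B * Bᴴ * Z + hᴴ * h) * Y = 0 := by
  have hZW : Zᴴ * W = 1 := by
    simpa using congrArg conjTranspose hWZ
  have hWC : Wᴴ * Cᴴ = -(Y * hᴴ) := by
    rw [Matrix.mul_add, ← Matrix.mul_assoc, ← Matrix.mul_assoc, hWZ, Matrix.one_mul] at hWR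
    exact eq_neg_of_add_eq_zero_left hWR
  have hCW : C * W = -(h * Yᴴ) := by
    simpa using congrArg conjTranspose hWC
  have hZA : Zᴴ * A = hᴴ * C + Hᴴ * Zᴴ := by
    simpa using congrArg conjTranspose hRAD
  have hAZ : Wᴴ * (Aᴴ * Z) = -(Y * hᴴ) * h + H := by
    rw [hRAD, Matrix.mul_add, ← Matrix.mul_assoc, ← Matrix.mul_assoc, hWC, hWZ, Matrix.one_mul]
  have hAW : (Zᴴ * A) * W = -(hᴴ * (h * Yᴴ)) + Hᴴ := by
    rw [hZA, Matrix.add_mul, Matrix.mul_assoc, Matrix.mul_assoc, hCW, hZW, Matrix.mul_one,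
      Matrix.mul_neg]
  have key : Wᴴ * (Aᴴ * (Z * Y * Zᴴ) + (Z * Y * Zᴴ) * A + Cᴴ * C
        - (Z * Y * Zᴴ) * B * Bᴴ * (Z * Y * Zᴴ)) * W
      = H * Y + Y * Hᴴ - Y * (Zᴴ * B * Bᴴ * Z + hᴴ * h) * Y := by
    calc _ = (Wᴴ * (Aᴴ * Z)) * Y * (Zᴴ * W) + (Wᴴ * Z) * Y * ((Zᴴ * A) * W)
          + (Wᴴ * Cᴴ) * (C * W)
          - (Wᴴ * Z) * Y * (Zᴴ * B * Bᴴ * Z) * Y * (Zᴴ * W) := by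
          simp only [Matrix.mul_add, Matrix.add_mul, Matrix.mul_sub, Matrix.sub_mul,
            Matrix.mul_assoc]
      _ = _ := by
          rw [hAZ, hAW, hWC, hCW, hWZ, hZW]
          simp only [Matrix.mul_add, Matrix.add_mul, Matrix.mul_neg, Matrix.neg_mul,
            Matrix.mul_assoc, Matrix.one_mul, Matrix.mul_one]
          abel
  rw [← key]
  generalize Aᴴ * (Z * Y * Zᴴ) + (Z * Y * Zᴴ) * A + Cᴴ * C
        - (Z * Y * Zᴴ) * B * Bᴴ * (Z * Y * Zᴴ) = R
  have hsandwich : (Z * Wᴴ) * R * (Z * Wᴴ)ᴴ = Z * (Wᴴ * R * W) * Zᴴ := by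
    simp only [conjTranspose_mul, conjTranspose_conjTranspose, Matrix.mul_assoc]
  rw [hsandwich]
  constructor
  · intro h0
    calc Wᴴ * R * W = (Wᴴ * Z) * (Wᴴ * R * W) * (Zᴴ * W) := by
          rw [hWZ, hZW, Matrix.one_mul, Matrix.mul_one]
      _ = Wᴴ * (Z * (Wᴴ * R * W) * Zᴴ) * W := by simp only [Matrix.mul_assoc]
      _ = 0 := by rw [h0, Matrix.mul_zero, Matrix.zero_mul]
  · intro h0
    rw [h0, Matrix.mul_zero, Matrix.zero_mul]
end

section
/- Let A ∈ ℂ^{n×n}, B ∈ ℂ^{n×m}, C ∈ ℂ^{p×n}. Let Z ∈ ℂ^{n×k}, h ∈ ℂ^{p×k}, H ∈ ℂ^{k×k} satisfy A*Z = C*h + Z·H. Let Y ∈ ℂ^{k×k} be invertible and Hermitian with Y^{−1}H + H*Y^{−1} = Z*BB*Z + h*h, and set S = Z*BB*Z, X = ZYZ*, R = C* + ZYh*. Suppose W̃ ∈ ℂ^{n×k} satisfies W̃*Z = I_k and W̃*R = 0. Then W̃*A*Z = −Yh*h + H = −YH*Y^{−1} + YS, and W̃*(A* − XBB*)Z = −YH*Y^{−1}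 = H − YS − Yh*h. -/
open Matrix

theorem stmt3 {n m p k : ℕ}
    (A : Matrix (Fin n) (Fin n) ℂ) (B : Matrix (Fin n) (Fin m) ℂ)
    (C : Matrix (Fin p) (Fin n) ℂ)
    (Z : Matrix (Fin n) (Fin k) ℂ)
    (h : Matrix (Fin p) (Fin k) ℂ) (H : Matrix (Fin k) (Fin k) ℂ)
    (hRAD : Aᴴ * Z = Cᴴ * h + Z * H)
    (Y : Matrix (Fin k) (Fin k) ℂ) (hYu : IsUnit Y) (hYh : Y.IsHermitian)
    (hYeq : Y⁻¹ * H + Hᴴ * Y⁻¹ = Zᴴ * B * Bᴴ * Z + hᴴ * h)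
    (W : Matrix (Fin n) (Fin k) ℂ)
    (hWZ : Wᴴ * Z = 1) (hWR : Wᴴ * (Cᴴ + Z * Y * hᴴ) = 0) :
    (Wᴴ * Aᴴ * Z = -(Y * hᴴ * h) + H ∧
      -(Y * hᴴ * h) + H = -(Y * Hᴴ * Y⁻¹) + Y * (Zᴴ * B * Bᴴ * Z)) ∧
    (Wᴴ * (Aᴴ - (Z * Y * Zᴴ) * B * Bᴴ) * Z = -(Y * Hᴴ * Y⁻¹) ∧
      -(Y * Hᴴ * Y⁻¹) = H - Y * (Zᴴ * B * Bᴴ * Z) - Y * hᴴ * h) := by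
  have hWC : Wᴴ * Cᴴ = -(Y * hᴴ) := by
    rw [Matrix.mul_add, Matrix.mul_assoc Z, ← Matrix.mul_assoc Wᴴ Z, hWZ, Matrix.one_mul] at hWR
    exact eq_neg_of_add_eq_zero_left hWR
  have hWA : Wᴴ * Aᴴ * Z = -(Y * hᴴ * h) + H := by
    rw [Matrix.mul_assoc, hRAD, Matrix.mul_add, ← Matrix.mul_assoc, ← Matrix.mul_assoc, hWC, hWZ,
      Matrix.one_mul, Matrix.neg_mul]
  have hYdet : IsUnit Y.det := (Matrix.isUnit_iff_isUnit_det Y).mp hYu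
  have hLyap : H + Y * Hᴴ * Y⁻¹ = Y * (Zᴴ * B * Bᴴ * Z) + Y * hᴴ * h := by
    have hY := congrArg (Y * ·) hYeq
    simpa only [Matrix.mul_add, Matrix.mul_nonsing_inv_cancel_left Y _ hYdet,
      ← Matrix.mul_assoc] using hY
  have hWX : Wᴴ * (Z * Y * Zᴴ * B * Bᴴ) * Z = Y * (Zᴴ * B * Bᴴ * Z) := by
    simp only [← Matrix.mul_assoc, hWZ, Matrix.one_mul]
  have hYHY : -(Y * Hᴴ * Y⁻¹) = H - Y * (Zᴴ * B * Bᴴ * Z) - Y * hᴴ * h := by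
    rw [sub_sub, ← hLyap]
    abel
  refine ⟨⟨hWA, ?_⟩, ?_, hYHY⟩
  · rw [hYHY]
    abel
  · rw [Matrix.mul_sub, Matrix.sub_mul, hWA, hWX, hYHY]
    abel
end

section
/- Let A ∈ ℂ^{n×n}, B ∈ ℂ^{n×m}, C ∈ ℂ^{p×n}. Let Z ∈ ℂ^{n×k}, h ∈ ℂ^{p×k}, H ∈ ℂ^{k×k} satisfy A*Z = C*h + Z·H. Let Y ∈ ℂ^{k×k} be invertible and Hermitian with Y^{−1}H + H*Y^{−1} = Z*BB*Z + h*h, set X = ZYZ*, R = C* + ZYh*, and let W̃ ∈ ℂ^{n×k} satisfy W̃*Z = I_k and W̃*R = 0. Then the spectrum of the matrix W̃*(A* − XBB*)Z equals the image of the spectrum of H under the map μ ↦ −conj(μ). -/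
open Matrix

/-- The compressed closed-loop matrix is similar to `-Hᴴ` through `Y`. -/
theorem compressed_eq_neg_conj {n m p k : ℕ}
    {A : Matrix (Fin n) (Fin n) ℂ} {B : Matrix (Fin n) (Fin m) ℂ}
    {C : Matrix (Fin p) (Fin n) ℂ} {Z : Matrix (Fin n) (Fin k) ℂ}
    {h : Matrix (Fin p) (Fin k) ℂ} {H Y : Matrix (Fin k) (Fin k) ℂ}
    (hRAD : Aᴴ * Z = Cᴴ * h + Z * H) (hYu : IsUnit Y)
    (hYeq : Y⁻¹ * H + Hᴴ * Y⁻¹ = Zᴴ * B * Bᴴ * Z + hᴴ * h)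
    {W : Matrix (Fin n) (Fin k) ℂ}
    (hWZ : Wᴴ * Z = 1) (hWR : Wᴴ * (Cᴴ + Z * Y * hᴴ) = 0) :
    Wᴴ * (Aᴴ - (Z * Y * Zᴴ) * B * Bᴴ) * Z = -(Y * Hᴴ * Y⁻¹) := by
  have hdet : IsUnit Y.det := (Matrix.isUnit_iff_isUnit_det Y).1 hYu
  have hWC : Wᴴ * Cᴴ = -(Y * hᴴ) := by
    rw [Matrix.mul_add, Matrix.mul_assoc Z, ← Matrix.mul_assoc Wᴴ Z, hWZ, Matrix.one_mul] at hWR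
    exact eq_neg_of_add_eq_zero_left hWR
  have hWA : Wᴴ * Aᴴ * Z = H - Y * (hᴴ * h) := by
    rw [Matrix.mul_assoc, hRAD, Matrix.mul_add, ← Matrix.mul_assoc, hWC, ← Matrix.mul_assoc, hWZ,
      Matrix.one_mul, Matrix.neg_mul, Matrix.mul_assoc]
    abel
  have hWX : Wᴴ * ((Z * Y * Zᴴ) * B * Bᴴ) * Z = Y * (Zᴴ * B * Bᴴ * Z) := by
    simp only [Matrix.mul_assoc]
    rw [← Matrix.mul_assoc Wᴴ Z, hWZ, Matrix.one_mul]
  have hY : H + Y * Hᴴ * Y⁻¹ = Y * (Zᴴ * B * Bᴴ * Z) + Y * (hᴴ * h) := by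
    rw [← Matrix.mul_add, ← hYeq, Matrix.mul_add, Matrix.mul_nonsing_inv_cancel_left _ _ hdet,
      Matrix.mul_assoc]
  rw [Matrix.mul_sub, Matrix.sub_mul, hWA, hWX, eq_neg_iff_add_eq_zero, sub_sub, sub_add_eq_add_sub,
    hY]
  abel

theorem stmt5 {n m p k : ℕ}
    (A : Matrix (Fin n) (Fin n) ℂ) (B : Matrix (Fin n) (Fin m) ℂ)
    (C : Matrix (Fin p) (Fin n) ℂ)
    (Z : Matrix (Fin n) (Fin k) ℂ)
    (h : Matrix (Fin p) (Fin k) ℂ) (H : Matrix (Fin k) (Fin k) ℂ)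
    (hRAD : Aᴴ * Z = Cᴴ * h + Z * H)
    (Y : Matrix (Fin k) (Fin k) ℂ) (hYu : IsUnit Y) (hYh : Y.IsHermitian)
    (hYeq : Y⁻¹ * H + Hᴴ * Y⁻¹ = Zᴴ * B * Bᴴ * Z + hᴴ * h)
    (W : Matrix (Fin n) (Fin k) ℂ)
    (hWZ : Wᴴ * Z = 1) (hWR : Wᴴ * (Cᴴ + Z * Y * hᴴ) = 0) :
    spectrum ℂ (Wᴴ * (Aᴴ - (Z * Y * Zᴴ) * B * Bᴴ) * Z) =
      (fun μ => -(starRingEnd ℂ μ)) '' spectrum ℂ H := by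
  rw [compressed_eq_neg_conj hRAD hYu hYeq hWZ hWR, ← spectrum.neg_eq]
  obtain ⟨u, rfl⟩ := hYu
  rw [← Matrix.coe_units_inv, spectrum.units_conjugate, ← Matrix.star_eq_conjTranspose,
    spectrum.map_star]
  ext μ
  simp only [Set.mem_neg, Set.mem_star, Set.mem_image]
  constructor
  · exact fun hμ => ⟨_, hμ, by simp⟩
  · rintro ⟨ν, hν, rfl⟩
    simpa using hν
end

section
/- Let A ∈ ℂ^{n×n}, B ∈ ℂ^{n×m}, C ∈ ℂ^{p×n}. Let Z ∈ ℂ^{n×k}, h ∈ ℂ^{p×k}, H ∈ ℂ^{k×k} satisfy A*Z = C*h + Z·H. Let Ỹ ∈ ℂ^{k×k} be Hermitian positive definite with Ỹ·H + H*·Ỹ = Z*BB*Z + h*h, and let G ∈ ℂ^{k×k} satisfy G*G = Ỹ (so G is invertible). Set Ẑ = Z·G^{−1}, ĥ = h·G^{−1}, Ĥ = G·H·G^{−1}, and R = C* + Z·Ỹ^{−1}·h*. Then: (i) 𝓡(Z·Ỹ^{−1}·Z*) = R·R*; (ii) Z·Ỹ^{−1}·Z* = Ẑ·Ẑ*; (iii)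 A*Ẑ = C*·ĥ + Ẑ·Ĥ; (iv) Ĥ + Ĥ* = Ẑ*BB*Ẑ + ĥ*ĥ; and (v) R = C* + Ẑ·ĥ*. -/
open Matrix
open scoped ComplexOrder

theorem stmt6 {n m p k : ℕ}
    (A : Matrix (Fin n) (Fin n) ℂ) (B : Matrix (Fin n) (Fin m) ℂ)
    (C : Matrix (Fin p) (Fin n) ℂ)
    (Z : Matrix (Fin n) (Fin k) ℂ)
    (h : Matrix (Fin p) (Fin k) ℂ) (H : Matrix (Fin k) (Fin k) ℂ)
    (hRAD : Aᴴ * Z = Cᴴ * h + Z * H)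
    (Yt : Matrix (Fin k) (Fin k) ℂ) (hYt : Yt.PosDef)
    (hYeq : Yt * H + Hᴴ * Yt = Zᴴ * B * Bᴴ * Z + hᴴ * h)
    (G : Matrix (Fin k) (Fin k) ℂ) (hG : Gᴴ * G = Yt) :
    (Aᴴ * (Z * Yt⁻¹ * Zᴴ) + (Z * Yt⁻¹ * Zᴴ) * A + Cᴴ * C
        - (Z * Yt⁻¹ * Zᴴ) * B * Bᴴ * (Z * Yt⁻¹ * Zᴴ) =
      (Cᴴ + Z * Yt⁻¹ * hᴴ) * (Cᴴ + Z * Yt⁻¹ * hᴴ)ᴴ) ∧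
    (Z * Yt⁻¹ * Zᴴ = (Z * G⁻¹) * (Z * G⁻¹)ᴴ) ∧
    (Aᴴ * (Z * G⁻¹) = Cᴴ * (h * G⁻¹) + (Z * G⁻¹) * (G * H * G⁻¹)) ∧
    ((G * H * G⁻¹) + (G * H * G⁻¹)ᴴ =
      (Z * G⁻¹)ᴴ * B * Bᴴ * (Z * G⁻¹) + (h * G⁻¹)ᴴ * (h * G⁻¹)) ∧
    (Cᴴ + Z * Yt⁻¹ * hᴴ = Cᴴ + (Z * G⁻¹) * (h * G⁻¹)ᴴ) := by
  have hGdet : IsUnit G.det := by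
    have hdet : IsUnit (Gᴴ * G).det := by
      rw [hG]
      exact (Matrix.isUnit_iff_isUnit_det Yt).mp hYt.isUnit
    rw [Matrix.det_mul] at hdet
    exact isUnit_of_mul_isUnit_right hdet
  have hWJ : Yt⁻¹ = G⁻¹ * (G⁻¹)ᴴ := by
    rw [← hG, Matrix.mul_inv_rev, Matrix.conjTranspose_nonsing_inv]
  have hGJ : G * G⁻¹ = 1 := Matrix.mul_nonsing_inv G hGdet
  have hJG : G⁻¹ * G = 1 := Matrix.nonsing_inv_mul G hGdet
  have hYdet : IsUnit Yt.det := (Matrix.isUnit_iff_isUnit_det Yt).mp hYt.isUnit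
  have hYW : Yt * Yt⁻¹ = 1 := Matrix.mul_nonsing_inv Yt hYdet
  have hWY : Yt⁻¹ * Yt = 1 := Matrix.nonsing_inv_mul Yt hYdet
  have hWherm : (Yt⁻¹)ᴴ = Yt⁻¹ := hYt.isHermitian.inv
  have hJsG : (G⁻¹)ᴴ * Gᴴ = 1 := by
    rw [← Matrix.conjTranspose_mul, hGJ, Matrix.conjTranspose_one]
  have hRAD' : Zᴴ * A = hᴴ * C + Hᴴ * Zᴴ := by
    simpa using congrArg Matrix.conjTranspose hRAD
  have hquad : Zᴴ * B * Bᴴ * Z = Yt * H + Hᴴ * Yt - hᴴ * h :=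
    eq_sub_of_add_eq hYeq.symm
  refine ⟨?_, ?_, ?_, ?_, ?_⟩
  · have hmid : Yt⁻¹ * (Zᴴ * B * Bᴴ * Z) * Yt⁻¹ =
        H * Yt⁻¹ + Yt⁻¹ * Hᴴ - Yt⁻¹ * hᴴ * h * Yt⁻¹ := by
      calc Yt⁻¹ * (Zᴴ * B * Bᴴ * Z) * Yt⁻¹
          = (Yt⁻¹ * Yt) * H * Yt⁻¹ + Yt⁻¹ * Hᴴ * (Yt * Yt⁻¹)
              - Yt⁻¹ * hᴴ * h * Yt⁻¹ := by
            rw [hquad]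
            simp only [Matrix.mul_sub, Matrix.sub_mul, Matrix.mul_add, Matrix.add_mul,
              Matrix.mul_assoc]
        _ = _ := by rw [hYW, hWY, Matrix.one_mul, Matrix.mul_one]
    calc _ = (Aᴴ * Z) * Yt⁻¹ * Zᴴ + Z * Yt⁻¹ * (Zᴴ * A) + Cᴴ * C
          - Z * (Yt⁻¹ * (Zᴴ * B * Bᴴ * Z) * Yt⁻¹) * Zᴴ := by
          simp only [Matrix.mul_assoc]
      _ = _ := by
          rw [hmid, hRAD, hRAD']
          simp only [Matrix.conjTranspose_add, Matrix.conjTranspose_mul,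
            Matrix.conjTranspose_conjTranspose, hWherm, Matrix.mul_sub, Matrix.sub_mul,
            Matrix.mul_add, Matrix.add_mul, Matrix.mul_assoc]
          abel
  · rw [hWJ, Matrix.conjTranspose_mul]
    simp only [Matrix.mul_assoc]
  · calc Aᴴ * (Z * G⁻¹) = Cᴴ * (h * G⁻¹) + Z * H * G⁻¹ := by
          rw [← Matrix.mul_assoc, hRAD, Matrix.add_mul, Matrix.mul_assoc Cᴴ]
      _ = Cᴴ * (h * G⁻¹) + Z * (G⁻¹ * G) * H * G⁻¹ := by rw [hJG, Matrix.mul_one]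
      _ = _ := by simp only [Matrix.mul_assoc]
  · calc G * H * G⁻¹ + (G * H * G⁻¹)ᴴ
        = ((G⁻¹)ᴴ * Gᴴ) * G * H * G⁻¹ + (G⁻¹)ᴴ * Hᴴ * Gᴴ * (G * G⁻¹) := by
          rw [hJsG, hGJ, Matrix.one_mul, Matrix.mul_one]
          simp only [Matrix.conjTranspose_mul, Matrix.mul_assoc]
      _ = (G⁻¹)ᴴ * ((Gᴴ * G) * H + Hᴴ * (Gᴴ * G)) * G⁻¹ := by
          simp only [Matrix.mul_add, Matrix.add_mul, Matrix.mul_assoc]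
      _ = _ := by
          rw [hG, hYeq]
          simp only [Matrix.conjTranspose_mul, Matrix.mul_add, Matrix.add_mul,
            Matrix.mul_assoc]
  · rw [hWJ, Matrix.conjTranspose_mul]
    simp only [Matrix.mul_assoc]
end

section
/- Let A ∈ ℂ^{n×n}, B ∈ ℂ^{n×m}, C ∈ ℂ^{p×n}. Let Z ∈ ℂ^{n×k}, h ∈ ℂ^{p×k}, H ∈ ℂ^{k×k} satisfy A*Z = C*h + Z·H. Let Y ∈ ℂ^{k×k} be Hermitian and invertible with Y^{−1}H + H*Y^{−1} = Z*BB*Z + h*h. Then the Riccati residual of X = ZYZ* factors as 𝓡(X) = R·R* with R = C* + Z·Y·h* ∈ ℂ^{n×p}; in particular 𝓡(X) is positive semidefinite of rank at most p. -/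
open Matrix
open scoped ComplexOrder

theorem stmt7 {n m p k : ℕ}
    (A : Matrix (Fin n) (Fin n) ℂ) (B : Matrix (Fin n) (Fin m) ℂ)
    (C : Matrix (Fin p) (Fin n) ℂ)
    (Z : Matrix (Fin n) (Fin k) ℂ)
    (h : Matrix (Fin p) (Fin k) ℂ) (H : Matrix (Fin k) (Fin k) ℂ)
    (hRAD : Aᴴ * Z = Cᴴ * h + Z * H)
    (Y : Matrix (Fin k) (Fin k) ℂ) (hYh : Y.IsHermitian) (hYu : IsUnit Y)
    (hYeq : Y⁻¹ * H + Hᴴ * Y⁻¹ = Zᴴ * B * Bᴴ * Z + hᴴ * h) :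
    (Aᴴ * (Z * Y * Zᴴ) + (Z * Y * Zᴴ) * A + Cᴴ * C
        - (Z * Y * Zᴴ) * B * Bᴴ * (Z * Y * Zᴴ) =
      (Cᴴ + Z * Y * hᴴ) * (Cᴴ + Z * Y * hᴴ)ᴴ) ∧
    (Aᴴ * (Z * Y * Zᴴ) + (Z * Y * Zᴴ) * A + Cᴴ * C
        - (Z * Y * Zᴴ) * B * Bᴴ * (Z * Y * Zᴴ)).PosSemidef ∧
    (Aᴴ * (Z * Y * Zᴴ) + (Z * Y * Zᴴ) * A + Cᴴ * C
        - (Z * Y * Zᴴ) * B * Bᴴ * (Z * Y * Zᴴ)).rank ≤ p := by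
  have hdet : IsUnit Y.det := (Matrix.isUnit_iff_isUnit_det Y).mp hYu
  have hlyap : H * Y + Y * Hᴴ = Y * (Zᴴ * B * Bᴴ * Z + hᴴ * h) * Y := by
    rw [← hYeq, Matrix.mul_add, Matrix.add_mul, Matrix.mul_nonsing_inv_cancel_left _ _ hdet,
      Matrix.mul_assoc Y, Matrix.nonsing_inv_mul_cancel_right _ _ hdet]
  have hadj : Zᴴ * A = hᴴ * C + Hᴴ * Zᴴ := by
    simpa using congrArg conjTranspose hRAD
  have hleft : Aᴴ * (Z * Y * Zᴴ) = Cᴴ * h * Y * Zᴴ + Z * (H * Y) * Zᴴ := by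
    rw [← Matrix.mul_assoc, ← Matrix.mul_assoc, hRAD]
    simp only [Matrix.add_mul, Matrix.mul_assoc]
  have hright : Z * Y * Zᴴ * A = Z * Y * hᴴ * C + Z * (Y * Hᴴ) * Zᴴ := by
    rw [Matrix.mul_assoc, hadj]
    simp only [Matrix.mul_add, Matrix.mul_assoc]
  have hfactor : Aᴴ * (Z * Y * Zᴴ) + (Z * Y * Zᴴ) * A + Cᴴ * C
        - (Z * Y * Zᴴ) * B * Bᴴ * (Z * Y * Zᴴ) =
      (Cᴴ + Z * Y * hᴴ) * (Cᴴ + Z * Y * hᴴ)ᴴ := by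
    have hmid := congrArg (fun M => Z * M * Zᴴ) hlyap
    rw [hleft, hright]
    simp only [conjTranspose_add, conjTranspose_mul, conjTranspose_conjTranspose, hYh.eq,
      Matrix.mul_add, Matrix.add_mul, Matrix.mul_assoc] at hmid ⊢
    rw [← sub_eq_zero] at hmid ⊢
    rw [← hmid]
    abel
  rw [hfactor]
  refine ⟨rfl, posSemidef_self_mul_conjTranspose _, ?_⟩
  exact (rank_mul_le_left _ _).trans (rank_le_width _)
end

section
/- Let A ∈ ℂ^{n×n}, let c ∈ ℂ^n, let Z ∈ ℂ^{n×j}, h ∈ ℂ^{1×j}, H ∈ ℂ^{j×j} satisfy A*Z = c·h + Z·H, and suppose Z has full column rank. If u ∈ ℂ^j is nonzero with h·u = 0 and H·u = μ·u for some μ ∈ ℂ, then Z·u ≠ 0 and A*(Z·u) = μ·(Z·u); in particular μ is an eigenvalue of A*. Consequently, if no eigenvalue of H is an eigenvalue of A*, then the pair (h, H) is observable (no common eigenvector of H lies in the kernel of h). -/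
open Matrix

theorem Matrix.mem_spectrum_of_mulVec_eq_smul {K ι : Type*} [Field K] [Fintype ι] [DecidableEq ι]
    {M : Matrix ι ι K} {v : ι → K} {μ : K} (hv : v ≠ 0) (hM : M *ᵥ v = μ • v) :
    μ ∈ spectrum K M := by
  rw [← Matrix.spectrum_toLin']
  exact (Module.End.hasEigenvalue_of_hasEigenvector
    (Module.End.hasEigenvector_iff.2
      ⟨Module.End.mem_eigenspace_iff.2 (by simpa using hM), hv⟩)).mem_spectrum

theorem stmt8 {n j : ℕ}
    (A : Matrix (Fin n) (Fin n) ℂ) (c : Fin n → ℂ)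
    (Z : Matrix (Fin n) (Fin j) ℂ)
    (h : Matrix (Fin 1) (Fin j) ℂ) (H : Matrix (Fin j) (Fin j) ℂ)
    (hRAD : Aᴴ * Z = (Matrix.of fun r (_ : Fin 1) => c r) * h + Z * H)
    (hZ : LinearIndependent ℂ (fun i => Zᵀ i)) :
    (∀ u : Fin j → ℂ, u ≠ 0 → h.mulVec u = 0 → ∀ μ : ℂ, H.mulVec u = μ • u →
      Z.mulVec u ≠ 0 ∧ Aᴴ.mulVec (Z.mulVec u) = μ • Z.mulVec u ∧ μ ∈ spectrum ℂ Aᴴ) ∧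
    ((∀ μ ∈ spectrum ℂ H, μ ∉ spectrum ℂ Aᴴ) →
      ∀ u : Fin j → ℂ, u ≠ 0 → (∃ μ : ℂ, H.mulVec u = μ • u) → h.mulVec u ≠ 0) := by
  have transfer : ∀ u : Fin j → ℂ, u ≠ 0 → h.mulVec u = 0 → ∀ μ : ℂ, H.mulVec u = μ • u →
      Z.mulVec u ≠ 0 ∧ Aᴴ.mulVec (Z.mulVec u) = μ • Z.mulVec u ∧ μ ∈ spectrum ℂ Aᴴ := by
    intro u hu hhu μ hHu
    have hZu : Z *ᵥ u ≠ 0 := fun h0 =>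
      hu (Matrix.mulVec_injective_iff.2 hZ (h0.trans (Matrix.mulVec_zero Z).symm))
    have hAZu : Aᴴ *ᵥ (Z *ᵥ u) = μ • Z *ᵥ u := by
      rw [Matrix.mulVec_mulVec, hRAD, Matrix.add_mulVec, ← Matrix.mulVec_mulVec,
        ← Matrix.mulVec_mulVec, hhu, hHu, Matrix.mulVec_zero, zero_add, Matrix.mulVec_smul]
    exact ⟨hZu, hAZu, Matrix.mem_spectrum_of_mulVec_eq_smul hZu hAZu⟩
  refine ⟨transfer, ?_⟩
  rintro hdisj u hu ⟨μ, hHu⟩ hhu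
  exact hdisj μ (Matrix.mem_spectrum_of_mulVec_eq_smul hu hHu) (transfer u hu hhu μ hHu).2.2
end

section
/- Let A1 ∈ ℂ^{n1×n1}, A2 ∈ ℂ^{n2×n2}, B1 ∈ ℂ^{n1×m}, B2 ∈ ℂ^{n2×m}, C1 ∈ ℂ^{p×n1}, C2 ∈ ℂ^{p×n2}. Let Z1 ∈ ℂ^{n1×k}, Z2 ∈ ℂ^{n2×k}, h1, h2 ∈ ℂ^{p×k}, H1, H2 ∈ ℂ^{k×k} satisfy A1*·Z1 = C1*·h1 + Z1·H1 and A2*·Z2 = C2*·h2 + Z2·H2. Let Y ∈ ℂ^{k×k} be invertible with Y^{−1}·H1 + H2*·Y^{−1} = Z2*B2B1*Z1 + h2*·h1. Then with X = Z1·Y·Z2*, the nonsymmetric Riccati residual factors as A1*X + XA2 + C1*C2 − XB2B1*X = R1·R2*, where R1 = C1* + Z1·Y·h2* ∈ ℂ^{n1×p} and R2 = C2* + Z2·Y*·h1* ∈ ℂ^{n2×p}; in particular the residual has rank at most p. -/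
open Matrix

theorem stmt12 {n1 n2 m p k : ℕ}
    (A1 : Matrix (Fin n1) (Fin n1) ℂ) (A2 : Matrix (Fin n2) (Fin n2) ℂ)
    (B1 : Matrix (Fin n1) (Fin m) ℂ) (B2 : Matrix (Fin n2) (Fin m) ℂ)
    (C1 : Matrix (Fin p) (Fin n1) ℂ) (C2 : Matrix (Fin p) (Fin n2) ℂ)
    (Z1 : Matrix (Fin n1) (Fin k) ℂ) (Z2 : Matrix (Fin n2) (Fin k) ℂ)
    (h1 h2 : Matrix (Fin p) (Fin k) ℂ)
    (H1 H2 : Matrix (Fin k) (Fin k) ℂ)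
    (hRAD1 : A1ᴴ * Z1 = C1ᴴ * h1 + Z1 * H1)
    (hRAD2 : A2ᴴ * Z2 = C2ᴴ * h2 + Z2 * H2)
    (Y : Matrix (Fin k) (Fin k) ℂ) (hYu : IsUnit Y)
    (hYeq : Y⁻¹ * H1 + H2ᴴ * Y⁻¹ = Z2ᴴ * B2 * B1ᴴ * Z1 + h2ᴴ * h1) :
    (A1ᴴ * (Z1 * Y * Z2ᴴ) + (Z1 * Y * Z2ᴴ) * A2 + C1ᴴ * C2
        - (Z1 * Y * Z2ᴴ) * B2 * B1ᴴ * (Z1 * Y * Z2ᴴ) =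
      (C1ᴴ + Z1 * Y * h2ᴴ) * (C2ᴴ + Z2 * Yᴴ * h1ᴴ)ᴴ) ∧
    (A1ᴴ * (Z1 * Y * Z2ᴴ) + (Z1 * Y * Z2ᴴ) * A2 + C1ᴴ * C2
        - (Z1 * Y * Z2ᴴ) * B2 * B1ᴴ * (Z1 * Y * Z2ᴴ)).rank ≤ p := by
  have hdet : IsUnit Y.det := (Matrix.isUnit_iff_isUnit_det Y).mp hYu
  have hA2 : Z2ᴴ * A2 = h2ᴴ * C2 + H2ᴴ * Z2ᴴ := by
    simpa using congrArg conjTranspose hRAD2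
  have hmid : H1 * Y + Y * H2ᴴ = Y * (Z2ᴴ * B2 * B1ᴴ * Z1 + h2ᴴ * h1) * Y := by
    rw [← hYeq, Matrix.mul_add, Matrix.add_mul, Matrix.mul_nonsing_inv_cancel_left _ _ hdet,
      ← Matrix.mul_assoc Y, Matrix.nonsing_inv_mul_cancel_right _ _ hdet]
  have hX1 : A1ᴴ * (Z1 * Y * Z2ᴴ) = C1ᴴ * h1 * Y * Z2ᴴ + Z1 * (H1 * Y) * Z2ᴴ := by
    rw [← Matrix.mul_assoc, ← Matrix.mul_assoc, hRAD1]
    simp only [Matrix.add_mul, Matrix.mul_assoc]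
  have hX2 : Z1 * Y * Z2ᴴ * A2 = Z1 * Y * h2ᴴ * C2 + Z1 * (Y * H2ᴴ) * Z2ᴴ := by
    rw [Matrix.mul_assoc (Z1 * Y), hA2]
    simp only [Matrix.mul_add, Matrix.mul_assoc]
  have hfactor : A1ᴴ * (Z1 * Y * Z2ᴴ) + (Z1 * Y * Z2ᴴ) * A2 + C1ᴴ * C2
        - (Z1 * Y * Z2ᴴ) * B2 * B1ᴴ * (Z1 * Y * Z2ᴴ) =
      (C1ᴴ + Z1 * Y * h2ᴴ) * (C2ᴴ + Z2 * Yᴴ * h1ᴴ)ᴴ := by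
    have hsum : Z1 * (H1 * Y) * Z2ᴴ + Z1 * (Y * H2ᴴ) * Z2ᴴ =
        Z1 * (Y * (Z2ᴴ * B2 * B1ᴴ * Z1 + h2ᴴ * h1) * Y) * Z2ᴴ := by
      rw [← hmid, Matrix.mul_add, Matrix.add_mul]
    rw [hX1, hX2, add_add_add_comm, hsum]
    simp only [conjTranspose_add, conjTranspose_mul, conjTranspose_conjTranspose,
      Matrix.mul_add, Matrix.add_mul, Matrix.mul_assoc]
    abel
  refine ⟨hfactor, ?_⟩
  rw [hfactor]
  exact (Matrix.rank_mul_le_left _ _).trans (Matrix.rank_le_width _)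
end

section
/- Let A ∈ ℂ^{n×n}, b ∈ ℂ^n, j ≥ 1, and let q ∈ ℂ[x] be a polynomial of degree d ≤ j such that q(A) is invertible; set l = j − d. Then q(A)^{−1}·𝒦_j(A,b) = 𝒦_l(A,b) + q(A)^{−1}·𝒦_d(A,b), as an equality of subspaces of ℂ^n (with the convention 𝒦_0(A,b) = {0}). -/
open Matrix Polynomial

/-- The Krylov subspace of order `j` consists of the vectors `p(A) b` with `p` of degree less
than `j`. -/
theorem mem_polyKrylov_iff {n : ℕ} {A : Matrix (Fin n) (Fin n) ℂ} {b : Fin n → ℂ} {j : ℕ}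
    {x : Fin n → ℂ} :
    x ∈ polyKrylov A b j ↔ ∃ p : ℂ[X], p.degree < j ∧ aeval A p *ᵥ b = x := by
  let L : ℂ[X] →ₗ[ℂ] (Fin n → ℂ) :=
    (Matrix.mulVecBilin ℂ ℂ).flip b ∘ₗ (aeval A).toLinearMap
  have h : polyKrylov A b j = (degreeLT ℂ j).map L := by
    rw [degreeLT_eq_span_X_pow, Submodule.map_span, polyKrylov]
    congr 1
    ext y
    simp [L, eq_comm]
  simp [h, mem_degreeLT, L]

theorem stmt15 {n j : ℕ} (hj : 1 ≤ j)
    (A : Matrix (Fin n) (Fin n) ℂ) (b : Fin n → ℂ)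
    (q : Polynomial ℂ) (hdeg : q.natDegree ≤ j) (hinv : IsUnit (aeval A q)) :
    ratKrylov A b j q = polyKrylov A b (j - q.natDegree) ⊔ ratKrylov A b q.natDegree q := by
  rcases eq_or_ne q 0 with rfl | hq
  · rw [map_zero, isUnit_zero_iff] at hinv
    have : Subsingleton (Fin n → ℂ) :=
      ⟨fun x y => by rw [← one_mulVec x, ← one_mulVec y, ← hinv, zero_mulVec, zero_mulVec]⟩
    exact Subsingleton.elim _ _
  have hdet := (Matrix.isUnit_iff_isUnit_det _).mp hinv
  have cancel (r : ℂ[X]) : (aeval A q)⁻¹ *ᵥ (aeval A (q * r) *ᵥ b) = aeval A r *ᵥ b := by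
    rw [map_mul, mulVec_mulVec, nonsing_inv_mul_cancel_left _ _ hdet]
  apply le_antisymm
  · rintro _ ⟨_, hx, rfl⟩
    obtain ⟨p, hp, rfl⟩ := mem_polyKrylov_iff.mp hx
    refine Submodule.mem_sup.mpr ⟨aeval A (p / q) *ᵥ b, mem_polyKrylov_iff.mpr ⟨p / q, ?_, rfl⟩,
      (aeval A q)⁻¹ *ᵥ (aeval A (p % q) *ᵥ b),
      ⟨_, mem_polyKrylov_iff.mpr ⟨p % q, ?_, rfl⟩, rfl⟩, ?_⟩
    · rcases lt_or_ge p.degree q.degree with hpq | hpq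
      · rw [(Polynomial.div_eq_zero_iff hq).mpr hpq, degree_zero]
        exact WithBot.bot_lt_coe _
      · have h := degree_add_div hq hpq
        rw [← h, degree_eq_natDegree hq] at hp
        by_cases h0 : p / q = 0
        · rw [h0, degree_zero]
          exact WithBot.bot_lt_coe _
        · rw [degree_eq_natDegree h0] at hp ⊢
          norm_cast at hp ⊢
          omega
    · rw [← degree_eq_natDegree hq]
      exact EuclideanDomain.mod_lt p hq
    · rw [← cancel, ← mulVec_add, ← add_mulVec, ← map_add, EuclideanDomain.div_add_mod]
      rfl
  · refine sup_le (fun x hx => ?_) (Submodule.map_mono fun x hx => ?_)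
    · obtain ⟨p, hp, rfl⟩ := mem_polyKrylov_iff.mp hx
      refine ⟨_, mem_polyKrylov_iff.mpr ⟨q * p, ?_, rfl⟩, cancel p⟩
      rcases eq_or_ne p 0 with rfl | h0
      · rw [mul_zero, degree_zero]
        exact WithBot.bot_lt_coe _
      · rw [degree_eq_natDegree h0] at hp
        rw [degree_mul, degree_eq_natDegree hq, degree_eq_natDegree h0]
        norm_cast at hp ⊢
        omega
    · obtain ⟨p, hp, rfl⟩ := mem_polyKrylov_iff.mp hx
      exact mem_polyKrylov_iff.mpr ⟨p, hp.trans_le (by exact_mod_cast hdeg), rfl⟩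
end

section
/- Let A ∈ ℂ^{n×n}, b ∈ ℂ^n, j ≥ 1, and let q, q̆ ∈ ℂ[x] be polynomials of degree at most j such that q(A) and q̆(A) are both invertible. Set b̆ = q(A)^{−1}·q̆(A)·b. Then q(A)^{−1}·𝒦_j(A,b) = q̆(A)^{−1}·𝒦_j(A,b̆), as an equality of subspaces of ℂ^n. -/
open Matrix Polynomial

/-- A unit of a monoid that commutes with `x` and with another unit can be moved through
the conjugation-like product `v⁻¹ x u⁻¹ v`. -/
theorem Units.inv_mul_mul_inv_mul_of_commute {M : Type*} [Monoid M] (u v : Mˣ) (x : M)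
    (hvx : Commute (v : M) x) (hux : Commute (u : M) x) (huv : Commute (u : M) v) :
    (↑v⁻¹ : M) * (x * (↑u⁻¹ * v)) = ↑u⁻¹ * x := by
  rw [Units.inv_mul_eq_iff_eq_mul, huv.units_inv_left.eq, ← mul_assoc, ← hvx.eq, mul_assoc,
    ← hux.units_inv_left.eq]

/-- A rational Krylov subspace is spanned by the vectors `q(A)⁻¹ Aⁱ b`. -/
theorem ratKrylov_eq_span {n : ℕ} (A : Matrix (Fin n) (Fin n) ℂ) (b : Fin n → ℂ) (j : ℕ)
    (q : Polynomial ℂ) :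
    ratKrylov A b j q =
      Submodule.span ℂ {x | ∃ i < j, x = ((aeval A q)⁻¹ * A ^ i).mulVec b} := by
  rw [ratKrylov, polyKrylov, Submodule.map_span]
  congr 1
  ext x
  constructor
  · rintro ⟨_, ⟨i, hi, rfl⟩, rfl⟩
    exact ⟨i, hi, by simp [Matrix.mulVec_mulVec]⟩
  · rintro ⟨i, hi, rfl⟩
    exact ⟨_, ⟨i, hi, rfl⟩, by simp [Matrix.mulVec_mulVec]⟩

/-- Polynomials in `A` commute with the powers of `A`. -/
theorem Polynomial.commute_aeval_pow {n : ℕ} (A : Matrix (Fin n) (Fin n) ℂ)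
    (p : Polynomial ℂ) (i : ℕ) : Commute (aeval A p) (A ^ i) := by
  simpa using (Commute.all p (X ^ i)).map (aeval A)

theorem stmt16 {n j : ℕ} (hj : 1 ≤ j)
    (A : Matrix (Fin n) (Fin n) ℂ) (b : Fin n → ℂ)
    (q qb : Polynomial ℂ) (hqdeg : q.natDegree ≤ j) (hqbdeg : qb.natDegree ≤ j)
    (hq : IsUnit (aeval A q)) (hqb : IsUnit (aeval A qb)) :
    ratKrylov A b j q =
      ratKrylov A ((aeval A q)⁻¹.mulVec ((aeval A qb).mulVec b)) j qb := by
  have key : ∀ i : ℕ, (aeval A qb)⁻¹ * (A ^ i * ((aeval A q)⁻¹ * aeval A qb)) =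
      (aeval A q)⁻¹ * A ^ i := by
    intro i
    have hqA := Polynomial.commute_aeval_pow A q i
    have hqbA := Polynomial.commute_aeval_pow A qb i
    have hqqb : Commute (aeval A q) (aeval A qb) := (Commute.all q qb).map (aeval A)
    obtain ⟨u, hu⟩ := hq
    obtain ⟨v, hv⟩ := hqb
    rw [← hu] at hqA hqqb ⊢
    rw [← hv] at hqbA hqqb ⊢
    rw [← Matrix.coe_units_inv, ← Matrix.coe_units_inv]
    exact Units.inv_mul_mul_inv_mul_of_commute u v _ hqbA hqA hqqb
  simp only [ratKrylov_eq_span, Matrix.mulVec_mulVec, mul_assoc, key]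
end

section
/- Let A ∈ ℂ^{n×n}, b ∈ ℂ^n, j ≥ 1, and let q ∈ ℂ[x] be a polynomial of degree at most j such that q(A) is invertible. Set 𝒱 = q(A)^{−1}·𝒦_j(A,b), and suppose dim 𝒱 = j and 𝒱 is A-variant (A·𝒱 ⊄ 𝒱). Then dim(𝒱 + A·𝒱) = j + 1 and 𝒱 + A·𝒱 = q(A)^{−1}·𝒦_{j+1}(A,b), where A·𝒱 denotes the image of 𝒱 under A. -/
open Matrix Polynomial

theorem polyKrylov_sup_map {n j : ℕ} (hj : 1 ≤ j) (A : Matrix (Fin n) (Fin n) ℂ)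
    (b : Fin n → ℂ) :
    polyKrylov A b j ⊔ (polyKrylov A b j).map A.mulVecLin = polyKrylov A b (j + 1) := by
  unfold polyKrylov
  rw [Submodule.map_span, ← Submodule.span_union]
  congr 1
  ext x
  constructor
  · rintro (⟨i, hi, rfl⟩ | ⟨_, ⟨i, hi, rfl⟩, rfl⟩)
    · exact ⟨i, by omega, rfl⟩
    · exact ⟨i + 1, by omega, by simp [pow_succ']⟩
  · rintro ⟨i, hi, rfl⟩
    rcases i with _ | i
    · exact Or.inl ⟨0, hj, rfl⟩
    · exact Or.inr ⟨_, ⟨i, by omega, rfl⟩, by simp [pow_succ']⟩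

theorem finrank_polyKrylov_le {n : ℕ} (A : Matrix (Fin n) (Fin n) ℂ) (b : Fin n → ℂ) (j : ℕ) :
    Module.finrank ℂ (polyKrylov A b j) ≤ j := by
  have h : polyKrylov A b j =
      Submodule.span ℂ (Set.range fun i : Fin j => (A ^ (i : ℕ)).mulVec b) := by
    unfold polyKrylov
    congr 1
    ext x
    constructor
    · rintro ⟨i, hi, rfl⟩
      exact ⟨⟨i, hi⟩, rfl⟩
    · rintro ⟨i, rfl⟩
      exact ⟨i, i.2, rfl⟩
  rw [h]
  simpa [Set.finrank] using
    finrank_range_le_card (R := ℂ) fun i : Fin j => (A ^ (i : ℕ)).mulVec b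

theorem ratKrylov_sup_map {n j : ℕ} (hj : 1 ≤ j) (A : Matrix (Fin n) (Fin n) ℂ)
    (b : Fin n → ℂ) (q : Polynomial ℂ) :
    ratKrylov A b j q ⊔ (ratKrylov A b j q).map A.mulVecLin = ratKrylov A b (j + 1) q := by
  have hcomm : A * (aeval A q)⁻¹ = (aeval A q)⁻¹ * A := by
    have h : Commute A (aeval A q) := by
      simpa using Polynomial.commute_X q |>.map (aeval A)
    by_cases hq : IsUnit (aeval A q).det
    · calc A * (aeval A q)⁻¹ = (aeval A q)⁻¹ * (aeval A q * A) * (aeval A q)⁻¹ := by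
            rw [Matrix.nonsing_inv_mul_cancel_left _ _ hq]
        _ = (aeval A q)⁻¹ * A := by
            rw [← h.eq, ← Matrix.mul_assoc, Matrix.mul_nonsing_inv_cancel_right _ _ hq]
    · simp [Matrix.nonsing_inv_apply_not_isUnit _ hq]
  unfold ratKrylov
  rw [← polyKrylov_sup_map hj, Submodule.map_sup, ← Submodule.map_comp, ← Submodule.map_comp,
    ← Matrix.mulVecLin_mul, ← Matrix.mulVecLin_mul, hcomm]

theorem stmt17 {n j : ℕ} (hj : 1 ≤ j)
    (A : Matrix (Fin n) (Fin n) ℂ) (b : Fin n → ℂ)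
    (q : Polynomial ℂ) (hdeg : q.natDegree ≤ j) (hinv : IsUnit (aeval A q))
    (hdim : Module.finrank ℂ (ratKrylov A b j q) = j)
    (hvar : ¬ (ratKrylov A b j q).map A.mulVecLin ≤ ratKrylov A b j q) :
    Module.finrank ℂ
        ((ratKrylov A b j q) ⊔ (ratKrylov A b j q).map A.mulVecLin : Submodule ℂ (Fin n → ℂ))
        = j + 1 ∧
      (ratKrylov A b j q) ⊔ (ratKrylov A b j q).map A.mulVecLin =
        ratKrylov A b (j + 1) q := by
  have hsup := ratKrylov_sup_map hj A b q
  refine ⟨le_antisymm ?_ ?_, hsup⟩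
  · rw [hsup]
    exact (Submodule.finrank_map_le _ _).trans (finrank_polyKrylov_le A b (j + 1))
  · have hlt := Submodule.finrank_lt_finrank_of_lt (left_lt_sup.mpr hvar)
    omega
end

section
/- Let A ∈ ℂ^{n×n}, B ∈ ℂ^{n×m}, C ∈ ℂ^{p×n}. Let V ∈ ℂ^{n×r}, K, G ∈ ℂ^{r×k}, v ∈ ℂ^{r×p} and Y ∈ ℂ^{k×k} satisfy A*·V·K = V·G and V·v = C*. Then for X = V·K·Y·K*·V* the Riccati residual satisfies 𝓡(X) = V·(G·Y·K* + K·Y·G* + v·v* − K·Y·S·Y·K*)·V*, where S = K*·V*·B·B*·V·K. -/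
open Matrix

theorem stmt19 {n m p r k : ℕ}
    (A : Matrix (Fin n) (Fin n) ℂ) (B : Matrix (Fin n) (Fin m) ℂ)
    (C : Matrix (Fin p) (Fin n) ℂ)
    (V : Matrix (Fin n) (Fin r) ℂ)
    (K G : Matrix (Fin r) (Fin k) ℂ)
    (v : Matrix (Fin r) (Fin p) ℂ)
    (Y : Matrix (Fin k) (Fin k) ℂ)
    (h1 : Aᴴ * V * K = V * G) (h2 : V * v = Cᴴ) :
    Aᴴ * (V * K * Y * Kᴴ * Vᴴ) + (V * K * Y * Kᴴ * Vᴴ) * A + Cᴴ * C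
        - (V * K * Y * Kᴴ * Vᴴ) * B * Bᴴ * (V * K * Y * Kᴴ * Vᴴ) =
      V * (G * Y * Kᴴ + K * Y * Gᴴ + v * vᴴ
        - K * Y * (Kᴴ * Vᴴ * B * Bᴴ * V * K) * Y * Kᴴ) * Vᴴ := by
  have h1' : Kᴴ * (Vᴴ * A) = Gᴴ * Vᴴ := by
    simpa [Matrix.conjTranspose_mul] using congrArg Matrix.conjTranspose h1
  have h2' : vᴴ * Vᴴ = C := by
    simpa [Matrix.conjTranspose_mul] using congrArg Matrix.conjTranspose h2
  have e1 : Aᴴ * (V * K * Y * Kᴴ * Vᴴ) = V * G * Y * Kᴴ * Vᴴ := by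
    rw [← h1]
    simp only [Matrix.mul_assoc]
  have e2 : (V * K * Y * Kᴴ * Vᴴ) * A = V * K * Y * Gᴴ * Vᴴ := by
    simp only [Matrix.mul_assoc, h1']
  have e3 : Cᴴ * C = V * v * vᴴ * Vᴴ := by
    rw [← h2, Matrix.mul_assoc (V * v), h2']
  rw [e1, e2, e3]
  simp only [Matrix.mul_add, Matrix.add_mul, Matrix.mul_sub, Matrix.sub_mul, Matrix.mul_assoc]
end
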